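/- arXiv:1909.09379 — 4 statements merged into one kernel-verified Lean document; each statement's English description precedes it below -/
import Mathlib

section
/- Let E be a real Banach space with a direct sum decomposition E = V ⊕ X, where V is finite dimensional. Let J ∈ C¹(E,ℝ) be an even functional with J(0) = 0 satisfying: (J1) there exist constants ρ, β > 0 such that J(u) ≥ β for all u ∈ X with ‖u‖ = ρ; (J2) there exists a subspace Ẽ of E with dim V < dim Ẽ < ∞ such that the set {u ∈ Ẽ : J(u) ≥ 0} is bounded in E; (J3) J satisfies the (PS)_c condition for every c ∈ [0, L], where L := sup_{u∈Ẽ} J(u). Then J possesses at least dim Ẽ − dim V pairs {u, −u} of nontrivial critical points. -/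
open Filter Topology

noncomputable section

/-- The Palais–Smale condition at level `c` for a `C¹` functional `J` on a Banach space:
every sequence along which `J` tends to `c` and `J'` tends to `0` in the dual norm has a
convergent subsequence. -/
def PalaisSmaleAt {E : Type*} [NormedAddCommGroup E] [NormedSpace ℝ E]
    (J : E → ℝ) (c : ℝ) : Prop :=
  ∀ u : ℕ → E, Tendsto (fun n => J (u n)) atTop (𝓝 c) →
    Tendsto (fun n => ‖fderiv ℝ J (u n)‖) atTop (𝓝 0) →
    ∃ (v : E) (φ : ℕ → ℕ), StrictMono φ ∧ Tendsto (fun k => u (φ k)) atTop (𝓝 v)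

namespace SymCrit

/-! ### Alternating lists -/

def altv : Bool → List Bool → ZMod 2
  | _, [] => 1
  | b, x :: l => if x = b then altv (!b) l else 0

theorem altv_zero_or_one (b : Bool) (l : List Bool) : altv b l = 0 ∨ altv b l = 1 := by
  induction l generalizing b with
  | nil => right; rfl
  | cons x l ih =>
    simp only [altv]
    split_ifs
    · exact ih _
    · left; rfl

theorem zmod2_add_self (x : ZMod 2) : x + x = 0 := CharTwo.add_self_eq_zero x

theorem fan_list {α : Type*} [DecidableEq α] (sg : α → Bool) (l : List α) (hl : l.Nodup) (b : Bool) :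
    (l.map (fun a => altv b ((l.erase a).map sg))).sum
      = altv b (l.map sg) + altv (!b) (l.map sg) := by
  induction l generalizing b with
  | nil => simp [altv]; rfl
  | cons x l ih =>
    have hx : x ∉ l := (List.nodup_cons.1 hl).1
    have hl' := (List.nodup_cons.1 hl).2
    have h1 : (l.map (fun a => altv b (((x :: l).erase a).map sg)))
        = l.map (fun a => if sg x = b then altv (!b) ((l.erase a).map sg) else 0) := by
      apply List.map_congr_left
      intro a ha
      have : x ≠ a := fun h => hx (h ▸ ha)
      rw [List.erase_cons_tail (by simpa using this)]
      simp [altv]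
    simp only [List.map_cons, List.sum_cons, List.erase_cons_head]
    rw [h1]
    by_cases hb : sg x = b
    · have := ih hl' (!b)
      simp only [hb, if_true, altv]
      rw [this]
      have h2 := zmod2_add_self (altv b (l.map sg))
      simp only [Bool.not_not]
      have hbb : b ≠ !b := by cases b <;> simp
      rw [if_neg hbb]
      linear_combination h2
    · have hb' : sg x = !b := by cases b <;> simp_all
      simp [altv, hb, hb']

theorem altv_neg {α : Type*} (sg : α → Bool) (f : α → α) (l : List α)
    (h : ∀ a ∈ l, sg (f a) = !sg a) (b : Bool) :
    altv (!b) ((l.map f).map sg) = altv b (l.map sg) := by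
  induction l generalizing b with
  | nil => rfl
  | cons x l ih =>
    simp only [List.map_cons, altv]
    rw [h x (by simp), ih (fun a ha => h a (by simp [ha]))]
    cases b <;> cases sg x <;> rfl

theorem altv_isChain (b : Bool) (l : List Bool) (h : altv b l = 1) :
    l.IsChain (· ≠ ·) ∧ ∀ i (hi : i < l.length), l[i] = (if i % 2 = 0 then b else !b) := by
  induction l generalizing b with
  | nil => simp
  | cons x l ih =>
    simp only [altv] at h
    split_ifs at h with hx
    · obtain ⟨h1, h2⟩ := ih _ h
      constructor
      · cases l with
        | nil => simp
        | cons y l =>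
          rw [List.isChain_cons_cons]
          refine ⟨?_, h1⟩
          have := h2 0 (by simp)
          simp at this
          rw [this, hx]; cases b <;> simp
      · intro i hi
        cases i with
        | zero => simpa using hx
        | succ i =>
          simp only [List.getElem_cons_succ]
          rw [h2 i (by simpa using hi)]
          rcases Nat.mod_two_eq_zero_or_one i with h | h
          · have : (i+1) % 2 = 1 := by omega
            simp [h, this]
          · have : (i+1) % 2 = 0 := by omega
            simp [h, this]
    · exact absurd h (by decide)

theorem altv_of_getElem (b : Bool) (l : List Bool)
    (h : ∀ i (hi : i < l.length), l[i] = (if i % 2 = 0 then b else !b)) : altv b l = 1 := by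
  induction l generalizing b with
  | nil => rfl
  | cons x l ih =>
    have h0 := h 0 (by simp)
    simp at h0
    simp only [altv, h0, if_true]
    apply ih
    intro i hi
    have := h (i+1) (by simpa using hi)
    simp only [List.getElem_cons_succ] at this
    rw [this]
    rcases Nat.mod_two_eq_zero_or_one i with h | h
    · have : (i+1) % 2 = 1 := by omega
      simp [h, this]
    · have : (i+1) % 2 = 0 := by omega
      simp [h, this]

section Alt
variable {α : Type*} [DecidableEq α] {K : Type*} [LinearOrder K]

def Alt (key : α → K) (sg : α → Bool) (b : Bool) (S : Finset α) : Prop :=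
  ∃ l : List α, l.toFinset = S ∧ l.Pairwise (fun x y => key x < key y) ∧ altv b (l.map sg) = 1

theorem nodup_of_pw {key : α → K} {l : List α} (h : l.Pairwise (fun x y => key x < key y)) :
    l.Nodup := h.imp (fun {a b} hab he => by subst he; exact lt_irrefl _ hab)

theorem exists_sorted (key : α → K) (S : Finset α) (h : Set.InjOn key S) :
    ∃ l : List α, l.toFinset = S ∧ l.Pairwise (fun x y => key x < key y) := by
  classical
  let r : α → α → Prop := fun x y => key x ≤ key y
  haveI : Std.Total r := ⟨fun a b => le_total _ _⟩
  haveI : IsTrans α r := ⟨fun a b c h1 h2 => le_trans h1 h2⟩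
  let l := List.insertionSort r S.toList
  have hperm : l.Perm S.toList := List.perm_insertionSort r _
  have hnd : l.Nodup := hperm.nodup_iff.2 (Finset.nodup_toList S)
  have hmem : ∀ a, a ∈ l ↔ a ∈ S := fun a => by rw [hperm.mem_iff, Finset.mem_toList]
  refine ⟨l, by ext a; simp [hmem], ?_⟩
  have h1 : l.Pairwise r := List.pairwise_insertionSort r _
  refine List.Pairwise.imp_of_mem ?_ (h1.and hnd)
  intro a b ha hb hab
  exact lt_of_le_of_ne hab.1 (fun he => hab.2 (h ((hmem a).1 ha) ((hmem b).1 hb) he))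

theorem sorted_unique {key : α → K} {l l' : List α}
    (h : l.Pairwise (fun x y => key x < key y)) (h' : l'.Pairwise (fun x y => key x < key y))
    (he : l.toFinset = l'.toFinset) : l = l' := by
  have hp : l.Perm l' := List.perm_of_nodup_nodup_toFinset_eq (nodup_of_pw h) (nodup_of_pw h') he
  exact List.Perm.eq_of_pairwise (fun a b _ _ h1 h2 => absurd h1 (lt_asymm h2)) h h' hp

open Classical in
theorem alt_value {key : α → K} {sg : α → Bool} {l : List α}
    (h : l.Pairwise (fun x y => key x < key y)) (b : Bool) :
    (if Alt key sg b l.toFinset then (1 : ZMod 2) else 0) = altv b (l.map sg) := by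
  split_ifs with hA
  · obtain ⟨l', h1, h2, h3⟩ := hA
    rw [sorted_unique h h2 h1.symm, h3]
  · rcases altv_zero_or_one b (l.map sg) with h0 | h0
    · exact h0.symm
    · exact absurd ⟨l, rfl, h, h0⟩ hA

open Classical in
theorem fan_finset (key : α → K) (sg : α → Bool) (b : Bool) (S : Finset α)
    (h : Set.InjOn key S) :
    ∑ a ∈ S, (if Alt key sg b (S.erase a) then (1 : ZMod 2) else 0)
      = (if Alt key sg b S then 1 else 0) + (if Alt key sg (!b) S then 1 else 0) := by
  obtain ⟨l, rfl, hl⟩ := exists_sorted key S h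
  rw [alt_value hl, alt_value hl, ← fan_list sg l (nodup_of_pw hl) b,
    List.sum_toFinset _ (nodup_of_pw hl)]
  congr 1
  apply List.map_congr_left
  intro a ha
  have h1 : l.toFinset.erase a = (l.erase a).toFinset := by
    ext x; simp [(nodup_of_pw hl).mem_erase_iff]
  rw [h1, alt_value]
  exact hl.sublist List.erase_sublist

theorem alt_image_neg {key : α → K} {sg : α → Bool} {b : Bool} {S : Finset α} (f : α → α)
    (hs : ∀ a ∈ S, sg (f a) = !sg a) (hk : ∀ a ∈ S, key (f a) = key a)
    (h : Alt key sg b S) : Alt key sg (!b) (S.image f) := by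
  obtain ⟨l, rfl, h2, h3⟩ := h
  refine ⟨l.map f, ?_, ?_, ?_⟩
  · ext x; simp
  · rw [List.pairwise_map]
    refine List.Pairwise.imp_of_mem ?_ h2
    intro a b ha hb hab
    rw [hk a (by simpa using ha), hk b (by simpa using hb)]; exact hab
  · rw [altv_neg sg f l (fun a ha => hs a (by simpa using ha))]; exact h3

/-- alternation, with no complementary pairs, forces classes to be strictly increasing -/
theorem alt_strict {c m : α → ℕ} {sg : α → Bool} {b : Bool} {S : Finset α}
    (hc : ∀ x ∈ S, ∀ y ∈ S, c x = c y → sg x = sg y)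
    (h : Alt (fun a => toLex (c a, m a)) sg b S) :
    ∃ l : List α, l.toFinset = S ∧ l.Nodup ∧ (l.map c).Pairwise (· < ·) ∧
      ∀ i (hi : i < l.length), sg l[i] = (if i % 2 = 0 then b else !b) := by
  obtain ⟨l, rfl, h2, h3⟩ := h
  obtain ⟨h4, h5⟩ := altv_isChain _ _ h3
  refine ⟨l, rfl, nodup_of_pw h2, ?_, ?_⟩
  · rw [← List.isChain_iff_pairwise, List.isChain_map]
    rw [List.isChain_map] at h4
    rw [List.isChain_iff_getElem] at h4 ⊢
    intro i hi
    have h6 := h4 i hi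
    have h7 := List.pairwise_iff_getElem.1 h2 i (i+1) (by omega) hi (by omega)
    rw [Prod.Lex.toLex_lt_toLex] at h7
    rcases h7 with h7 | h7
    · exact h7
    · exact absurd (hc _ (by simp) _ (by simp) h7.1) h6
  · intro i hi
    have := h5 i (by simpa using hi)
    simpa using this

theorem strict_list_ge (l : List ℕ) (h : l.Pairwise (· < ·)) :
    ∀ i (hi : i < l.length), i ≤ l[i] := by
  intro i
  induction i with
  | zero => intro _; exact Nat.zero_le _
  | succ i ih =>
    intro hi
    have h1 := ih (by omega)
    have h2 := List.pairwise_iff_getElem.1 h i (i+1) (by omega) hi (by omega)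
    omega

theorem strict_list_eq (n : ℕ) (l : List ℕ) (h : l.Pairwise (· < ·)) (hn : l.length = n)
    (hb : ∀ x ∈ l, x < n) : ∀ i (hi : i < l.length), l[i] = i := by
  have key : ∀ k, ∀ i (hi : i < l.length), i + k + 1 = n → l[i] = i := by
    intro k
    induction k with
    | zero =>
      intro i hi hk
      have h1 := strict_list_ge l h i hi
      have h2 := hb l[i] (by simp)
      omega
    | succ k ih =>
      intro i hi hk
      have h0 := strict_list_ge l h i hi
      have h1 := ih (i+1) (by omega) (by omega)
      have h2 := List.pairwise_iff_getElem.1 h i (i+1) (by omega) (by omega) (by omega)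
      omega
  intro i hi
  exact key (n - i - 1) i hi (by omega)

end Alt


/-! ### Walks: cyclically ordered simplices of the Kuhn triangulation -/

section Walks
variable {M : ℕ}

def ev (i : Fin (M+2)) : Fin (M+1) → ℤ := fun j =>
  (if i = j.castSucc then 1 else 0) - (if i = j.succ then 1 else 0)

theorem ev_inj_aux (i i' : Fin (M+2)) (h : i < i') : ev i ≠ ev i' := by
  intro he
  have hi : i ≠ Fin.last _ := (lt_of_lt_of_le h (Fin.le_last _)).ne
  have := congrFun he (i.castPred hi)
  have h1 : i ≠ (i.castPred hi).succ := by
    intro h2; have := congrArg Fin.val h2; simp at this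
  have h2 : i' ≠ (i.castPred hi).castSucc := by
    simp; exact h.ne'
  unfold ev at this
  rw [if_neg h1, if_neg h2] at this
  simp only [Fin.castSucc_castPred, if_true] at this
  split_ifs at this <;> omega

theorem ev_inj : Function.Injective (ev (M := M)) := by
  intro i i' h
  rcases lt_trichotomy i i' with h1 | h1 | h1
  · exact absurd h (ev_inj_aux _ _ h1)
  · exact h1
  · exact absurd h.symm (ev_inj_aux _ _ h1)

def IsWalk (p : Fin (M+2) → Fin (M+1) → ℤ) : Prop :=
  ∃ π : Equiv.Perm (Fin (M+2)), ∀ k, p (k+1) - p k = ev (π k)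

theorem walk_formula {p : Fin (M+2) → Fin (M+1) → ℤ} {π : Equiv.Perm (Fin (M+2))}
    (h : ∀ k, p (k+1) - p k = ev (π k)) (i : Fin (M+1)) (k : Fin (M+2)) :
    p k i = p 0 i + (if π.symm i.castSucc < k then 1 else 0)
      - (if π.symm i.succ < k then 1 else 0) := by
  induction k using Fin.induction with
  | zero => simp
  | succ j ih =>
    have h1 := congrFun (h j.castSucc) i
    rw [Fin.coeSucc_eq_succ] at h1
    simp only [Pi.sub_apply, ev] at h1
    have h2 : ∀ a : Fin (M+2), (if π.symm a < j.succ then (1:ℤ) else 0)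
        = (if π.symm a < j.castSucc then 1 else 0) + (if π j.castSucc = a then 1 else 0) := by
      intro a
      have : π j.castSucc = a ↔ π.symm a = j.castSucc := by
        rw [Equiv.symm_apply_eq]; exact eq_comm
      rw [if_congr this rfl rfl]
      rcases lt_trichotomy (π.symm a) j.castSucc with h | h | h
      · rw [if_pos h, if_neg h.ne, if_pos]; · rfl
        exact h.trans (Fin.castSucc_lt_succ)
      · rw [if_neg h.not_lt, if_pos h, if_pos]; · rfl
        rw [h]; exact Fin.castSucc_lt_succ
      · rw [if_neg h.not_gt, if_neg h.ne', if_neg]; · rfl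
        rw [not_lt]; exact Fin.castSucc_lt_iff_succ_le.1 h
    rw [h2, h2]
    linarith

theorem walk_diff {p : Fin (M+2) → Fin (M+1) → ℤ} (h : IsWalk p) (k l : Fin (M+2))
    (i : Fin (M+1)) : |p k i - p l i| ≤ 1 := by
  obtain ⟨π, hπ⟩ := h
  rw [walk_formula hπ i k, walk_formula hπ i l, abs_le]
  have key : (∀ k, π.symm i.castSucc < k → π.symm i.succ < k) ∨
      (∀ k, π.symm i.succ < k → π.symm i.castSucc < k) := by
    rcases le_total (π.symm i.castSucc) (π.symm i.succ) with h | h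
    · right; intro k hk; exact lt_of_le_of_lt h hk
    · left; intro k hk; exact lt_of_le_of_lt h hk
  rcases key with h | h
  · have h1 := h k; have h2 := h l
    split_ifs <;> first | omega | (exfalso; tauto)
  · have h1 := h k; have h2 := h l
    split_ifs <;> first | omega | (exfalso; tauto)

theorem walk_inj {p : Fin (M+2) → Fin (M+1) → ℤ} (h : IsWalk p) : Function.Injective p := by
  obtain ⟨π, hπ⟩ := h
  have aux : ∀ j k : Fin (M+2), j < k → p j ≠ p k := by
    intro j k hjk he
    have h1 : ∀ i : Fin (M+1), (j ≤ π.symm i.castSucc ∧ π.symm i.castSucc < k) ↔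
        (j ≤ π.symm i.succ ∧ π.symm i.succ < k) := by
      intro i
      have h2 := congrFun he i
      rw [walk_formula hπ i k, walk_formula hπ i j] at h2
      split_ifs at h2 <;> first | omega | (constructor <;> intro _ <;> constructor <;> omega)
    have h2 : ∀ a : Fin (M+2), (j ≤ π.symm a ∧ π.symm a < k) ↔
        (j ≤ π.symm 0 ∧ π.symm 0 < k) := by
      intro a
      induction a using Fin.induction with
      | zero => rfl
      | succ i ih => rw [← h1 i]; exact ih
    have h3 := h2 (π j)
    have h4 := h2 (π k)
    rw [← h4] at h3
    simp at h3
    exact absurd h3 (not_le.2 hjk)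
  intro j k he
  rcases lt_trichotomy j k with h1 | h1 | h1
  · exact absurd he (aux _ _ h1)
  · exact h1
  · exact absurd he.symm (aux _ _ h1)

theorem walk_no_antipodal {p : Fin (M+2) → Fin (M+1) → ℤ} (h : IsWalk p) {k l : Fin (M+2)}
    (hk : p k = - p l) : p k = 0 := by
  funext i
  have h1 := walk_diff h k l i
  have h2 := congrFun hk i
  simp only [Pi.neg_apply] at h2
  rw [abs_le] at h1
  simp only [Pi.zero_apply]
  omega

def refl0 (p : Fin (M+2) → Fin (M+1) → ℤ) : Fin (M+2) → Fin (M+1) → ℤ :=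
  Function.update p 0 (p (-1) + p 1 - p 0)

theorem one_ne_zero_fin : (1 : Fin (M+2)) ≠ 0 := by
  intro h; have := congrArg Fin.val h; simp at this

theorem neg_one_ne_zero_fin : (-1 : Fin (M+2)) ≠ 0 := by
  intro h; exact one_ne_zero_fin (neg_eq_zero.1 h)

theorem refl0_walk {p : Fin (M+2) → Fin (M+1) → ℤ} (h : IsWalk p) : IsWalk (refl0 p) := by
  obtain ⟨π, hπ⟩ := h
  refine ⟨(Equiv.swap 0 (-1)).trans π, fun k => ?_⟩
  have h1 := one_ne_zero_fin (M := M)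
  have h2 := neg_one_ne_zero_fin (M := M)
  simp only [Equiv.trans_apply, refl0]
  have a0 := hπ 0
  have a1 := hπ (-1)
  rw [zero_add] at a0
  rw [neg_add_cancel] at a1
  by_cases hk : k = 0
  · subst hk
    rw [Equiv.swap_apply_left, zero_add, Function.update_of_ne h1, Function.update_self, ← a1]
    abel
  by_cases hk' : k = -1
  · subst hk'
    rw [Equiv.swap_apply_right, neg_add_cancel, Function.update_of_ne h2, Function.update_self, ← a0]
    abel
  rw [Equiv.swap_apply_of_ne_of_ne hk hk', Function.update_of_ne hk, Function.update_of_ne, hπ]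
  intro h; exact hk' (eq_neg_of_add_eq_zero_left h)

theorem refl0_refl0 (p : Fin (M+2) → Fin (M+1) → ℤ) : refl0 (refl0 p) = p := by
  have h1 := one_ne_zero_fin (M := M)
  have h2 := neg_one_ne_zero_fin (M := M)
  funext k
  by_cases hk : k = 0
  · subst hk
    simp [refl0, Function.update_of_ne h1, Function.update_of_ne h2]
  · simp [refl0, Function.update_of_ne hk]

theorem refl0_of_ne (p : Fin (M+2) → Fin (M+1) → ℤ) {k : Fin (M+2)} (hk : k ≠ 0) :
    refl0 p k = p k := by simp [refl0, Function.update_of_ne hk]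

theorem refl0_ne {p : Fin (M+2) → Fin (M+1) → ℤ} (h : IsWalk p) : refl0 p ≠ p := by
  intro he
  obtain ⟨π, hπ⟩ := h
  have a0 := hπ 0
  have a1 := hπ (-1)
  rw [zero_add] at a0
  rw [neg_add_cancel] at a1
  have h3 := congrFun he 0
  simp only [refl0, Function.update_self] at h3
  have h4 : p 1 - p 0 = p 0 - p (-1) := by
    rw [← sub_eq_zero] at h3 ⊢; rw [← h3]; abel
  rw [a0, a1] at h4
  exact neg_one_ne_zero_fin (π.injective (ev_inj h4)).symm

theorem rot_walk {p : Fin (M+2) → Fin (M+1) → ℤ} (h : IsWalk p) (j : Fin (M+2)) :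
    IsWalk (fun k => p (k + j)) := by
  obtain ⟨π, hπ⟩ := h
  refine ⟨(Equiv.addRight j).trans π, fun k => ?_⟩
  have := hπ (k + j)
  simp only [Equiv.trans_apply, Equiv.coe_addRight]
  rw [← this]
  congr 2
  abel

theorem anti_walk {p : Fin (M+2) → Fin (M+1) → ℤ} (h : IsWalk p) :
    IsWalk (fun k => - p (1 - k)) := by
  obtain ⟨π, hπ⟩ := h
  refine ⟨(Equiv.neg _).trans π, fun k => ?_⟩
  have := hπ (-k)
  simp only [Equiv.trans_apply, Equiv.neg_apply]
  rw [← this]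
  have h1 : (1 - (k+1) : Fin (M+2)) = -k := by abel
  have h2 : (1 - k : Fin (M+2)) = -k + 1 := by abel
  rw [h1, h2]
  abel

theorem walk_unique_normal {p : Fin (M+2) → Fin (M+1) → ℤ} (h : IsWalk p) :
    ∃! j, p (j+1) - p j = ev 0 := by
  obtain ⟨π, hπ⟩ := h
  refine ⟨π.symm 0, by simp [hπ], fun j hj => ?_⟩
  have hj : p (j+1) - p j = ev 0 := hj
  rw [hπ] at hj
  have := ev_inj hj
  rw [← this]; simp

theorem walk_finite (W : Set (Fin (M+1) → ℤ)) (hW : W.Finite) :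
    {p : Fin (M+2) → Fin (M+1) → ℤ | IsWalk p ∧ ∀ k ≠ 0, p k ∈ W}.Finite := by
  let W' : Set (Fin (M+1) → ℤ) := W ∪ ⋃ i : Fin (M+2), (fun v => v - ev i) '' W
  have hW' : W'.Finite := hW.union (Set.finite_iUnion (fun i => hW.image _))
  refine (Set.Finite.pi (fun _ : Fin (M+2) => hW')).subset ?_
  rintro p ⟨⟨π, hπ⟩, hp⟩ k _
  by_cases hk : k = 0
  · right
    subst hk
    rw [Set.mem_iUnion]
    refine ⟨π 0, p 1, hp 1 one_ne_zero_fin, ?_⟩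
    have := hπ 0
    rw [zero_add] at this
    simp only [← this]
    abel
  · exact Or.inl (hp k hk)

end Walks


/-! ### The combinatorial core -/

section Comb
variable {M : ℕ}

def fc (v : Fin (M+1) → ℤ) : ℕ := sInf {i | ∃ h : i < M+1, v ⟨i, h⟩ ≠ 0}

theorem fc_spec {v : Fin (M+1) → ℤ} (hv : v ≠ 0) : ∃ h : fc v < M+1, v ⟨fc v, h⟩ ≠ 0 := by
  have : {i | ∃ h : i < M+1, v ⟨i, h⟩ ≠ 0}.Nonempty := by
    obtain ⟨j, hj⟩ := Function.ne_iff.1 hv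
    exact ⟨j, j.2, hj⟩
  exact Nat.sInf_mem this

theorem fc_eq {v : Fin (M+1) → ℤ} (i : Fin (M+1)) (h : v i ≠ 0) (h' : ∀ j < i, v j = 0) :
    fc v = i := by
  have hv : v ≠ 0 := fun he => h (by rw [he]; rfl)
  apply le_antisymm
  · exact Nat.sInf_le ⟨i.2, h⟩
  · by_contra hlt
    obtain ⟨h1, h2⟩ := fc_spec hv
    exact h2 (h' ⟨fc v, h1⟩ (by rw [Fin.lt_def]; exact not_le.1 hlt))

theorem fc_neg (v : Fin (M+1) → ℤ) : fc (-v) = fc v := by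
  unfold fc; simp

open Classical in
def fs (v : Fin (M+1) → ℤ) : Bool := decide (∃ h : fc v < M+1, 0 < v ⟨fc v, h⟩ * (-1)^(fc v))

theorem fs_true {v : Fin (M+1) → ℤ} (i : Fin (M+1)) (h : fc v = i) :
    fs v = decide (0 < v i * (-1)^(i : ℕ)) := by
  unfold fs
  rw [decide_eq_decide]
  constructor
  · rintro ⟨h1, h2⟩
    have : (⟨fc v, h1⟩ : Fin (M+1)) = i := Fin.ext h
    rw [this, h] at h2; exact h2
  · intro h2
    have h1 : fc v < M+1 := h ▸ i.2
    refine ⟨h1, ?_⟩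
    have : (⟨fc v, h1⟩ : Fin (M+1)) = i := Fin.ext h
    rw [this, h]; exact h2

theorem fs_neg {v : Fin (M+1) → ℤ} (hv : v ≠ 0) : fs (-v) = !fs v := by
  obtain ⟨h1, h2⟩ := fc_spec hv
  rw [fs_true ⟨fc v, h1⟩ rfl, fs_true (v := -v) ⟨fc v, h1⟩ (fc_neg v), ← decide_not,
    decide_eq_decide]
  rcases neg_one_pow_eq_or ℤ (fc v) with h | h <;> simp only [h, Pi.neg_apply] <;> omega

theorem fs_walk {p : Fin (M+2) → Fin (M+1) → ℤ} (h : IsWalk p) {k l : Fin (M+2)}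
    (hk : p k ≠ 0) (hl : p l ≠ 0) (he : fc (p k) = fc (p l)) : fs (p k) = fs (p l) := by
  obtain ⟨h1, h2⟩ := fc_spec hk
  obtain ⟨h3, h4⟩ := fc_spec hl
  rw [fs_true ⟨fc (p k), h1⟩ rfl, fs_true (v := p l) ⟨fc (p k), h1⟩ he.symm, decide_eq_decide]
  have h5 := walk_diff h k l ⟨fc (p k), h1⟩
  have h6 : p l ⟨fc (p k), h1⟩ ≠ 0 := by
    have : (⟨fc (p k), h1⟩ : Fin (M+1)) = ⟨fc (p l), h3⟩ := Fin.ext he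
    rw [this]; exact h4
  rw [abs_le] at h5
  rcases neg_one_pow_eq_or ℤ (fc (p k)) with h | h <;> simp only [h] <;> omega

/-- the standard walk from `0`. -/
def pstar (k : Fin (M+2)) : Fin (M+1) → ℤ := fun i =>
  if k = i.succ then 1 else 0

theorem pstar_walk : IsWalk (pstar (M := M)) := by
  refine ⟨Equiv.refl _, fun k => ?_⟩
  funext i
  simp only [pstar, Pi.sub_apply, Equiv.refl_apply, ev]
  congr 1
  exact if_congr (by rw [← Fin.coeSucc_eq_succ, add_left_inj]) rfl rfl

theorem pstar_zero : pstar (M := M) 0 = 0 := by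
  funext i; simp [pstar, (Fin.succ_ne_zero i).symm]

theorem fc_pstar (j : Fin (M+1)) : fc (pstar j.succ) = j := by
  apply fc_eq
  · simp [pstar]
  · intro i hi; simp [pstar]; exact hi.ne'

theorem pstar_bdd (k : Fin (M+2)) (i : Fin (M+1)) : |pstar k i| ≤ 1 := by
  unfold pstar; split_ifs <;> simp

def facet (p : Fin (M+2) → Fin (M+1) → ℤ) : Finset (Fin (M+1) → ℤ) :=
  (Finset.univ.erase 0).image p

theorem mem_facet {p : Fin (M+2) → Fin (M+1) → ℤ} {v} : v ∈ facet p ↔ ∃ k ≠ 0, p k = v := by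
  simp [facet]

theorem facet_card {p : Fin (M+2) → Fin (M+1) → ℤ} (h : IsWalk p) : (facet p).card = M+1 := by
  unfold facet
  rw [Finset.card_image_of_injective _ (walk_inj h)]
  simp

theorem facet_refl0 (p : Fin (M+2) → Fin (M+1) → ℤ) : facet (refl0 p) = facet p := by
  ext v
  rw [mem_facet, mem_facet]
  constructor
  · rintro ⟨k, hk, h⟩; exact ⟨k, hk, by rwa [refl0_of_ne p hk] at h⟩
  · rintro ⟨k, hk, h⟩; exact ⟨k, hk, by rwa [refl0_of_ne p hk]⟩

/-- uniqueness of the alternating link walk -/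
theorem link_unique {p : Fin (M+2) → Fin (M+1) → ℤ} (h : IsWalk p) (h0 : p 0 = 0)
    {c m : (Fin (M+1) → ℤ) → ℕ} {sg : (Fin (M+1) → ℤ) → Bool}
    (hc : ∀ k ≠ 0, c (p k) = fc (p k)) (hs : ∀ k ≠ 0, sg (p k) = fs (p k))
    (hA : Alt (fun a => toLex (c a, m a)) sg true (facet p)) : p = pstar := by
  have hne : ∀ k ≠ 0, p k ≠ 0 := fun k hk he => hk (walk_inj h (by rw [he, h0]))
  obtain ⟨l, h1, h2, h3, h4⟩ := alt_strict (c := c) (m := m) (by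
    intro x hx y hy hxy
    obtain ⟨k, hk, rfl⟩ := mem_facet.1 hx
    obtain ⟨k', hk', rfl⟩ := mem_facet.1 hy
    rw [hc k hk, hc k' hk'] at hxy
    rw [hs k hk, hs k' hk']
    exact fs_walk h (hne k hk) (hne k' hk') hxy) hA
  have hlen : l.length = M+1 := by
    rw [← List.toFinset_card_of_nodup h2, h1, facet_card h]
  have h5 := strict_list_eq (M+1) (l.map c) h3 (by simpa using hlen) (by
    intro x hx
    obtain ⟨v, hv, rfl⟩ := List.mem_map.1 hx
    have hv' : v ∈ facet p := by rw [← h1]; simpa using hv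
    obtain ⟨k, hk, rfl⟩ := mem_facet.1 hv'
    rw [hc k hk]; exact (fc_spec (hne k hk)).1)
  obtain ⟨π, hπ⟩ := h
  have hmono : StrictMono π.symm := by
    rw [Fin.strictMono_iff_lt_succ]
    intro i
    have hi : (i : ℕ) < l.length := by rw [hlen]; exact i.2
    have h6 := h5 i (by simpa using hi)
    simp only [List.getElem_map] at h6
    have h7 := h4 i hi
    have hv' : l[(i:ℕ)] ∈ facet p := by rw [← h1]; simp
    obtain ⟨k, hk, hkl⟩ := mem_facet.1 hv'
    rw [← hkl, hc k hk] at h6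
    rw [← hkl, hs k hk, fs_true i h6] at h7
    have h8 : 0 < p k i := by
      rcases Nat.mod_two_eq_zero_or_one i with h | h
      · rw [if_pos h, decide_eq_true_iff, (Nat.even_iff.2 h).neg_one_pow] at h7; omega
      · rw [if_neg (by omega)] at h7
        simp only [Bool.not_true, decide_eq_false_iff_not] at h7
        rw [(Nat.odd_iff.2 h).neg_one_pow] at h7
        have : p k i ≠ 0 := by
          obtain ⟨h9, h10⟩ := fc_spec (hne k hk)
          have : (⟨fc (p k), h9⟩ : Fin (M+1)) = i := Fin.ext h6
          rwa [this] at h10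
        omega
    rw [walk_formula hπ i k, h0] at h8
    by_contra hlt
    rw [not_lt] at hlt
    simp only [Pi.zero_apply] at h8
    split_ifs at h8 <;> omega
  have hid : ∀ a, π.symm a = a := by
    intro a
    have hs : Function.Surjective π.symm := π.symm.surjective
    have e : (StrictMono.orderIsoOfSurjective _ hmono hs) = OrderIso.refl _ := Subsingleton.elim _ _
    have := congrArg (fun f : Fin (M+2) ≃o Fin (M+2) => f a) e
    simpa using this
  funext k i
  rw [walk_formula hπ i k, h0, hid, hid]
  simp only [pstar, Pi.zero_apply, Fin.lt_def, Fin.ext_iff, Fin.val_castSucc, Fin.val_succ]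
  split_ifs <;> omega

theorem link_exists {c m : (Fin (M+1) → ℤ) → ℕ} {sg : (Fin (M+1) → ℤ) → Bool}
    (hc : ∀ k ≠ 0, c (pstar k) = fc (pstar k)) (hs : ∀ k ≠ 0, sg (pstar k) = fs (pstar k)) :
    Alt (fun a => toLex (c a, m a)) sg true (facet (pstar (M := M))) := by
  refine ⟨List.ofFn (fun j : Fin (M+1) => pstar j.succ), ?_, ?_, ?_⟩
  · ext v
    rw [mem_facet]
    simp only [List.mem_toFinset, List.mem_ofFn, Set.mem_range]
    constructor
    · rintro ⟨j, rfl⟩; exact ⟨j.succ, Fin.succ_ne_zero j, rfl⟩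
    · rintro ⟨k, hk, rfl⟩
      obtain ⟨j, rfl⟩ := Fin.exists_succ_eq.2 hk
      exact ⟨j, rfl⟩
  · rw [List.pairwise_ofFn]
    intro i j hij
    rw [Prod.Lex.toLex_lt_toLex]
    left
    simp only
    rw [hc _ (Fin.succ_ne_zero _), hc _ (Fin.succ_ne_zero _), fc_pstar, fc_pstar]
    exact hij
  · apply altv_of_getElem
    intro i hi
    simp only [List.length_map, List.length_ofFn] at hi
    simp only [List.getElem_map, List.getElem_ofFn]
    rw [hs _ (Fin.succ_ne_zero _), fs_true ⟨i, hi⟩ (fc_pstar _)]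
    rcases Nat.mod_two_eq_zero_or_one i with h | h
    · rw [if_pos h, (Nat.even_iff.2 h).neg_one_pow]; simp [pstar]
    · rw [if_neg (by omega), (Nat.odd_iff.2 h).neg_one_pow]; simp [pstar]

open Classical in
theorem comb (W : Set (Fin (M+1) → ℤ)) (hW : W.Finite) (hWs : ∀ v ∈ W, -v ∈ W)
    (c : (Fin (M+1) → ℤ) → ℕ) (sg : (Fin (M+1) → ℤ) → Bool)
    (hcn : ∀ v ∈ W, v ≠ 0 → c (-v) = c v) (hsn : ∀ v ∈ W, v ≠ 0 → sg (-v) = !sg v)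
    (hlink : ∀ v : Fin (M+1) → ℤ, (∀ i, |v i| ≤ 1) → v ∈ W ∧ (v ≠ 0 → c v = fc v ∧ sg v = fs v))
    (hbd : ∀ p : Fin (M+2) → Fin (M+1) → ℤ, IsWalk p → p 0 ∉ W → (∀ k ≠ 0, p k ∈ W) →
      (∀ k ≠ 0, c (p k) < M) ∧
      ∀ k ≠ 0, ∀ l ≠ 0, c (p k) = c (p l) → sg (p k) = sg (p l)) : False := by
  obtain ⟨enc, henc⟩ := exists_injective_nat (Fin (M+1) → ℤ)
  set m : (Fin (M+1) → ℤ) → ℕ := fun v => min (enc v) (enc (-v)) with hm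
  have hmn : ∀ v, m (-v) = m v := fun v => by simp [hm, min_comm]
  have hmi : ∀ v w, m v = m w → v = w ∨ v = -w := by
    intro v w h
    simp only [hm] at h
    rcases min_choice (enc v) (enc (-v)) with h1 | h1 <;>
    rcases min_choice (enc w) (enc (-w)) with h2 | h2 <;> rw [h1, h2] at h <;> have h3 := henc h
    · exact Or.inl h3
    · exact Or.inr h3
    · right; rw [← h3]; simp
    · left; exact neg_injective h3
  set key : (Fin (M+1) → ℤ) → ℕ ×ₗ ℕ := fun a => toLex (c a, m a) with hkey
  have hkn : ∀ v ∈ W, v ≠ 0 → key (-v) = key v := fun v hv h => by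
    simp only [hkey, hmn, hcn v hv h]
  have hinj : ∀ p : Fin (M+2) → Fin (M+1) → ℤ, IsWalk p → (∀ k, p k ≠ 0) →
      Set.InjOn key (Finset.univ.image p : Finset _) := by
    intro p hp h0 v hv w hw hvw
    simp only [Finset.coe_image, Finset.coe_univ, Set.image_univ, Set.mem_range] at hv hw
    obtain ⟨k, rfl⟩ := hv
    obtain ⟨l, rfl⟩ := hw
    have h1 : m (p k) = m (p l) := by
      have := congrArg (fun x => (ofLex x).2) hvw
      simpa [hkey] using this
    rcases hmi _ _ h1 with h | h
    · exact h
    · exact absurd (walk_no_antipodal hp h) (h0 k)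
  let val : (Fin (M+2) → Fin (M+1) → ℤ) → ZMod 2 := fun p =>
    if Alt key sg true (facet p) then 1 else 0
  have hTf : {p : Fin (M+2) → Fin (M+1) → ℤ | IsWalk p ∧ ∀ k ≠ 0, p k ∈ W ∧ p k ≠ 0}.Finite :=
    (walk_finite W hW).subset (fun p hp => ⟨hp.1, fun k hk => (hp.2 k hk).1⟩)
  let T := hTf.toFinset
  have hT : ∀ p, p ∈ T ↔ IsWalk p ∧ ∀ k ≠ 0, p k ∈ W ∧ p k ≠ 0 := fun p => by simp [T]
  -- total sum vanishes
  have hsum : ∑ p ∈ T, val p = 0 := by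
    refine Finset.sum_involution (fun p _ => refl0 p) ?_ ?_ ?_ ?_
    · intro p _
      simp only [val, facet_refl0]
      exact zmod2_add_self _
    · intro p hp _
      exact refl0_ne ((hT p).1 hp).1
    · intro p hp
      rw [hT] at hp ⊢
      refine ⟨refl0_walk hp.1, fun k hk => ?_⟩
      rw [refl0_of_ne p hk]; exact hp.2 k hk
    · intro p _
      exact refl0_refl0 p
  -- exterior part
  have h3 : ∀ p ∈ T, p 0 ∉ W → val p = 0 := by
    intro p hp h0
    rw [hT] at hp
    obtain ⟨b1, b2⟩ := hbd p hp.1 h0 (fun k hk => (hp.2 k hk).1)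
    simp only [val]
    rw [if_neg]
    intro hA
    obtain ⟨l, a1, a2, a3, a4⟩ := alt_strict (c := c) (m := m) (by
      intro x hx y hy hxy
      obtain ⟨k, hk, rfl⟩ := mem_facet.1 hx
      obtain ⟨k', hk', rfl⟩ := mem_facet.1 hy
      exact b2 k hk k' hk' hxy) hA
    have hlen : l.length = M+1 := by
      rw [← List.toFinset_card_of_nodup a2, a1, facet_card hp.1]
    have a5 := strict_list_ge (l.map c) a3 M (by simp [hlen])
    simp only [List.getElem_map] at a5
    have hM : M < l.length := by omega
    have hv' : l[M] ∈ facet p := by rw [← a1]; simp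
    obtain ⟨k, hk, hkl⟩ := mem_facet.1 hv'
    have := b1 k hk
    rw [hkl] at this
    omega
  have h0W : (0 : Fin (M+1) → ℤ) ∈ W := (hlink 0 (by simp)).1
  -- the part around the origin
  have hpsT : pstar ∈ T := by
    rw [hT]
    refine ⟨pstar_walk, fun k hk => ⟨(hlink _ (pstar_bdd k)).1, fun h => hk ?_⟩⟩
    exact walk_inj pstar_walk (by rw [h, pstar_zero])
  have h2 : ∑ p ∈ T with p 0 = 0, val p = 1 := by
    rw [Finset.sum_eq_single_of_mem pstar]
    · simp only [val]
      rw [if_pos]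
      apply link_exists
      · intro k hk
        exact ((hlink _ (pstar_bdd k)).2 (((hT _).1 hpsT).2 k hk).2).1
      · intro k hk
        exact ((hlink _ (pstar_bdd k)).2 (((hT _).1 hpsT).2 k hk).2).2
    · simp [hpsT, pstar_zero]
    · intro p hp hne
      rw [Finset.mem_filter, hT] at hp
      simp only [val]
      rw [if_neg]
      intro hA
      have hb : ∀ k i, |p k i| ≤ 1 := by
        intro k i
        have := walk_diff hp.1.1 k 0 i
        rw [hp.2] at this; simpa using this
      exact hne (link_unique hp.1.1 hp.2
        (fun k hk => ((hlink _ (hb k)).2 (hp.1.2 k hk).2).1)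
        (fun k hk => ((hlink _ (hb k)).2 (hp.1.2 k hk).2).2) hA)
  -- interior part
  let T1 := T.filter (fun p => p 0 ∈ W ∧ p 0 ≠ 0)
  have hT1 : ∀ p, p ∈ T1 ↔ IsWalk p ∧ ∀ k, p k ∈ W ∧ p k ≠ 0 := by
    intro p
    simp only [T1, Finset.mem_filter, hT]
    constructor
    · rintro ⟨⟨a, b⟩, d⟩
      refine ⟨a, fun k => ?_⟩
      by_cases hk : k = 0
      · rw [hk]; exact d
      · exact b k hk
    · rintro ⟨a, b⟩
      exact ⟨⟨a, fun k _ => b k⟩, b 0⟩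
  have h1 : ∑ p ∈ T1, val p = 0 := by
    let A : Bool → (Fin (M+2) → Fin (M+1) → ℤ) → ZMod 2 := fun b p =>
      if Alt key sg b (Finset.univ.image p) then 1 else 0
    have s1 : ∑ p ∈ T1, val p
        = ∑ p ∈ T1, ∑ j, (if p (j+1) - p j = ev 0 then val p else 0) := by
      refine Finset.sum_congr rfl (fun p hp => ?_)
      obtain ⟨j, hj, hj'⟩ := walk_unique_normal ((hT1 p).1 hp).1
      rw [Finset.sum_eq_single j]
      · rw [if_pos hj]
      · intro b _ hb
        rw [if_neg (fun h => hb (hj' b h))]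
      · simp
    have s2 : ∀ j : Fin (M+2), ∑ p ∈ T1, (if p (j+1) - p j = ev 0 then val p else 0)
        = ∑ p ∈ T1, (if p 1 - p 0 = ev 0 then val (fun k => p (k + -j)) else 0) := by
      intro j
      refine Finset.sum_nbij' (fun p k => p (k + j)) (fun p k => p (k + -j)) ?_ ?_ ?_ ?_ ?_
      · intro p hp
        rw [hT1] at hp ⊢
        exact ⟨rot_walk hp.1 j, fun k => hp.2 _⟩
      · intro p hp
        rw [hT1] at hp ⊢
        exact ⟨rot_walk hp.1 (-j), fun k => hp.2 _⟩
      · intro p hp; funext k; simp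
      · intro p hp; funext k; simp
      · intro p hp
        simp [add_comm]
    have s3 : ∀ p ∈ T1, ∑ j : Fin (M+2), val (fun k => p (k + -j)) = A true p + A false p := by
      intro p hp
      rw [hT1] at hp
      have := fan_finset key sg true (Finset.univ.image p) (hinj p hp.1 (fun k => (hp.2 k).2))
      rw [Finset.sum_image (fun a _ b _ h => walk_inj hp.1 h)] at this
      rw [← Equiv.sum_comp (Equiv.neg (Fin (M+2)))]
      simp only [A]
      rw [Bool.not_true] at this
      rw [← this]
      refine Finset.sum_congr rfl (fun j _ => ?_)
      simp only [val]
      congr 2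
      ext v
      rw [mem_facet]
      simp only [Finset.mem_erase, Finset.mem_image, Finset.mem_univ, true_and, Equiv.neg_apply,
        neg_neg]
      constructor
      · rintro ⟨k, hk, rfl⟩
        exact ⟨fun h => hk (by simpa using walk_inj hp.1 h), _, rfl⟩
      · rintro ⟨h1, k, rfl⟩
        refine ⟨k - j, fun h => h1 ?_, by simp⟩
        rw [sub_eq_zero.1 h]
    have s4 : ∑ p ∈ T1, (if p 1 - p 0 = ev 0 then A true p else 0)
        = ∑ p ∈ T1, (if p 1 - p 0 = ev 0 then A false p else 0) := by
      have hmem : ∀ p ∈ T1, (fun k => - p (1 - k)) ∈ T1 := by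
        intro p hp
        rw [hT1] at hp ⊢
        exact ⟨anti_walk hp.1, fun k => ⟨hWs _ (hp.2 _).1, neg_ne_zero.2 (hp.2 _).2⟩⟩
      have himg : ∀ p : Fin (M+2) → Fin (M+1) → ℤ,
          Finset.univ.image (fun k => - p (1 - k)) = (Finset.univ.image p).image (fun v => -v) := by
        intro p
        ext v
        simp only [Finset.mem_image, Finset.mem_univ, true_and]
        constructor
        · rintro ⟨k, rfl⟩; exact ⟨_, ⟨_, rfl⟩, rfl⟩
        · rintro ⟨_, ⟨k, rfl⟩, rfl⟩; exact ⟨1 - k, by simp⟩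
      have hAA : ∀ b, ∀ p ∈ T1, Alt key sg b (Finset.univ.image p) →
          Alt key sg (!b) (Finset.univ.image (fun k => - p (1 - k))) := by
        intro b p hp h
        rw [himg]
        rw [hT1] at hp
        refine alt_image_neg _ ?_ ?_ h
        · intro a ha
          obtain ⟨k, -, rfl⟩ := Finset.mem_image.1 ha
          exact hsn _ (hp.2 k).1 (hp.2 k).2
        · intro a ha
          obtain ⟨k, -, rfl⟩ := Finset.mem_image.1 ha
          exact hkn _ (hp.2 k).1 (hp.2 k).2
      have hinv : ∀ p : Fin (M+2) → Fin (M+1) → ℤ,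
          (fun k => - (fun k => - p (1 - k)) (1 - k)) = p := by
        intro p; funext k; simp
      refine Finset.sum_nbij' (fun p k => - p (1 - k)) (fun p k => - p (1 - k)) hmem hmem
        (fun p _ => hinv p) (fun p _ => hinv p) ?_
      intro p hp
      have e1 : (- p (1 - 1) - - p (1 - 0) : Fin (M+1) → ℤ) = p 1 - p 0 := by
        simp; abel
      simp only [e1]
      have e2 : A true p = A false (fun k => - p (1 - k)) := by
        simp only [A]
        refine if_congr ⟨fun h => hAA true p hp h, fun h => ?_⟩ rfl rfl
        have := hAA false _ (hmem p hp) h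
        rw [hinv p] at this
        exact this
      rw [e2]
    rw [s1, Finset.sum_comm, Finset.sum_congr rfl (fun j _ => s2 j), Finset.sum_comm]
    have s5 : ∀ p ∈ T1, ∑ j : Fin (M+2), (if p 1 - p 0 = ev 0 then val (fun k => p (k + -j)) else 0)
        = (if p 1 - p 0 = ev 0 then A true p else 0) + (if p 1 - p 0 = ev 0 then A false p else 0) := by
      intro p hp
      split_ifs
      · exact s3 p hp
      · simp
    rw [Finset.sum_congr rfl s5, Finset.sum_add_distrib, s4]
    exact zmod2_add_self _
  -- conclusion
  have hsplit : ∑ p ∈ T, val p = ∑ p ∈ T1, val p + ∑ p ∈ T with p 0 = 0, val p := by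
    simp only [T1]
    rw [Finset.sum_filter, Finset.sum_filter, ← Finset.sum_add_distrib]
    refine Finset.sum_congr rfl (fun p hp => ?_)
    by_cases a : p 0 ∈ W
    · by_cases b : p 0 = 0
      · simp [b]
      · simp [a, b]
    · have b : p 0 ≠ 0 := fun h => a (h ▸ h0W)
      simp [a, b, h3 p hp a]
  rw [hsum, h1, h2] at hsplit
  exact absurd hsplit (by decide)

end Comb


/-! ### The Borsuk-type intersection theorem -/

theorem borsuk_std {M : ℕ} (G : (Fin (M+1) → ℝ) → (Fin M → ℝ)) (hG : Continuous G)
    (hGo : ∀ x, G (-x) = - G x) (s : (Fin (M+1) → ℝ) → ℝ) (hs : Continuous s)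
    (hse : ∀ x, s (-x) = s x) (hs0 : s 0 < 0) (R : ℝ) (hR : ∀ x, R ≤ ‖x‖ → 0 < s x) :
    ∃ x, G x = 0 ∧ s x = 0 := by
  classical
  by_contra hcon
  push Not at hcon
  have hRpos : 0 < R := by
    by_contra h
    have := hR 0 (by simpa using h)
    linarith
  -- lower bound
  have hcpt : IsCompact (Metric.closedBall (0 : Fin (M+1) → ℝ) (R+1)) := isCompact_closedBall _ _
  have hne : (Metric.closedBall (0 : Fin (M+1) → ℝ) (R+1)).Nonempty := ⟨0, by simp; linarith⟩
  obtain ⟨x0, -, hx0⟩ := hcpt.exists_isMinOn hne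
    (f := fun x => ‖G x‖ + |s x|) (by fun_prop)
  set a := ‖G x0‖ + |s x0| with ha
  have hapos : 0 < a := by
    by_cases h : G x0 = 0
    · have := hcon x0 h
      have h1 : 0 < |s x0| := abs_pos.2 this
      have := norm_nonneg (G x0)
      linarith
    · have h1 : 0 < ‖G x0‖ := norm_pos_iff.2 h
      have := abs_nonneg (s x0)
      linarith
  set ε := min (a / 2) (-(s 0) / 2) with hε
  have hεpos : 0 < ε := by
    apply lt_min <;> linarith
  have hε1 : ε ≤ a / 2 := min_le_left _ _
  have hε2 : ε ≤ -(s 0) / 2 := min_le_right _ _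
  have hlow : ∀ x ∈ Metric.closedBall (0 : Fin (M+1) → ℝ) (R+1), |s x| < ε → ε ≤ ‖G x‖ := by
    intro x hx hsx
    have : a ≤ ‖G x‖ + |s x| := hx0 hx
    linarith
  -- uniform continuity
  have huG := hcpt.uniformContinuousOn_of_continuous hG.continuousOn
  have hus := hcpt.uniformContinuousOn_of_continuous hs.continuousOn
  rw [Metric.uniformContinuousOn_iff] at huG hus
  obtain ⟨d1, hd1, huG⟩ := huG ε hεpos
  obtain ⟨d2, hd2, hus⟩ := hus ε hεpos
  set h := min (min d1 d2) 1 / 2 with hh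
  have hhpos : 0 < h := by
    have : 0 < min (min d1 d2) 1 := lt_min (lt_min hd1 hd2) one_pos
    linarith
  have hh1 : h < d1 := by
    have : min (min d1 d2) 1 ≤ d1 := (min_le_left _ _).trans (min_le_left _ _)
    linarith
  have hh2 : h < d2 := by
    have : min (min d1 d2) 1 ≤ d2 := (min_le_left _ _).trans (min_le_right _ _)
    linarith
  have hh3 : h < 1 := by
    have : min (min d1 d2) 1 ≤ 1 := min_le_right _ _
    linarith
  let X : (Fin (M+1) → ℤ) → (Fin (M+1) → ℝ) := fun v i => h * v i
  have hXneg : ∀ v, X (-v) = - X v := by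
    intro v; funext i; simp [X]
  have hX0 : X 0 = 0 := by funext i; simp [X]
  have hXd : ∀ v w : Fin (M+1) → ℤ, (∀ i, |v i - w i| ≤ 1) → dist (X v) (X w) ≤ h := by
    intro v w hvw
    rw [dist_pi_le_iff hhpos.le]
    intro i
    simp only [X, Real.dist_eq]
    rw [← mul_sub, abs_mul, abs_of_pos hhpos]
    have : |(v i : ℝ) - w i| ≤ 1 := by exact_mod_cast hvw i
    nlinarith
  let W : Set (Fin (M+1) → ℤ) := {v | s (X v) ≤ 0}
  have hWR : ∀ v ∈ W, ‖X v‖ < R := by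
    intro v hv
    by_contra hlt
    have := hR _ (not_lt.1 hlt)
    simp only [W, Set.mem_setOf_eq] at hv
    linarith
  have hWb : ∀ v ∈ W, X v ∈ Metric.closedBall (0 : Fin (M+1) → ℝ) (R+1) := by
    intro v hv
    rw [mem_closedBall_zero_iff]; have := hWR v hv; linarith
  have hWfin : W.Finite := by
    refine (Set.Finite.pi (fun _ : Fin (M+1) => Set.finite_Icc (-⌈R/h⌉) ⌈R/h⌉)).subset ?_
    intro v hv i _
    have h1 := (norm_le_pi_norm (X v) i).trans (hWR v hv).le
    simp only [X, Real.norm_eq_abs, abs_mul, abs_of_pos hhpos] at h1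
    have h2 : |(v i : ℝ)| ≤ R / h := by rw [le_div_iff₀ hhpos]; linarith
    have h3 : |(v i : ℝ)| ≤ (⌈R/h⌉ : ℤ) := h2.trans (Int.le_ceil _)
    have h4 : |v i| ≤ ⌈R/h⌉ := by exact_mod_cast h3
    exact abs_le.1 h4
  have hW0 : (0 : Fin (M+1) → ℤ) ∈ W := by
    simp only [W, Set.mem_setOf_eq, hX0]; exact hs0.le
  have hWs : ∀ v ∈ W, -v ∈ W := by
    intro v hv
    simp only [W, Set.mem_setOf_eq, hXneg, hse] at hv ⊢; exact hv
  -- labels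
  let gc : (Fin (M+1) → ℤ) → ℕ := fun v => sInf {i : ℕ | ∃ hi : i < M, ε ≤ |G (X v) ⟨i, hi⟩|}
  let gs : (Fin (M+1) → ℤ) → Bool := fun v => decide (∃ hi : gc v < M, 0 < G (X v) ⟨gc v, hi⟩)
  have hgspec : ∀ v ∈ W, -ε < s (X v) → ∃ hi : gc v < M, ε ≤ |G (X v) ⟨gc v, hi⟩| := by
    intro v hv hsv
    have h1 : ε ≤ ‖G (X v)‖ := by
      apply hlow _ (hWb v hv)
      simp only [W, Set.mem_setOf_eq] at hv
      rw [abs_lt]; constructor <;> linarith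
    have : {i : ℕ | ∃ hi : i < M, ε ≤ |G (X v) ⟨i, hi⟩|}.Nonempty := by
      by_contra hemp
      rw [Set.not_nonempty_iff_eq_empty] at hemp
      have h2 : ‖G (X v)‖ < ε := by
        rw [pi_norm_lt_iff hεpos]
        intro i
        by_contra hlt
        have : (i : ℕ) ∈ ({i : ℕ | ∃ hi : i < M, ε ≤ |G (X v) ⟨i, hi⟩|}) := ⟨i.2, not_lt.1 hlt⟩
        rw [hemp] at this
        exact this
      linarith
    exact Nat.sInf_mem this
  have hgcn : ∀ v, gc (-v) = gc v := by
    intro v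
    simp only [gc, hXneg, hGo, Pi.neg_apply, abs_neg]
  have hgsv : ∀ v (i : Fin M), gc v = i → gs v = decide (0 < G (X v) i) := by
    intro v i hi
    simp only [gs, decide_eq_decide]
    constructor
    · rintro ⟨h1, h2⟩
      have : (⟨gc v, h1⟩ : Fin M) = i := Fin.ext hi
      rwa [this] at h2
    · intro h2
      have h1 : gc v < M := hi ▸ i.2
      refine ⟨h1, ?_⟩
      have : (⟨gc v, h1⟩ : Fin M) = i := Fin.ext hi
      rwa [this]
  let c : (Fin (M+1) → ℤ) → ℕ := fun v => if -ε < s (X v) then gc v else fc v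
  let sg : (Fin (M+1) → ℤ) → Bool := fun v => if -ε < s (X v) then gs v else fs v
  refine comb W hWfin hWs c sg ?_ ?_ ?_ ?_
  · intro v _ _
    simp only [c, hXneg, hse, hgcn, fc_neg]
  · intro v hv hv0
    simp only [sg, hXneg, hse]
    split_ifs with hif
    · obtain ⟨h1, h2⟩ := hgspec v hv hif
      rw [hgsv v ⟨gc v, h1⟩ rfl, hgsv (-v) ⟨gc v, h1⟩ (hgcn v), ← decide_not, decide_eq_decide,
        hXneg, hGo]
      simp only [Pi.neg_apply]
      have : G (X v) ⟨gc v, h1⟩ ≠ 0 := by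
        intro h; rw [h, abs_zero] at h2; linarith
      constructor
      · intro h; linarith
      · intro h; rcases lt_or_gt_of_ne this with h | h <;> linarith
    · exact fs_neg hv0
  · intro v hv
    have h1 : dist (X v) (X 0) ≤ h := hXd v 0 (by simpa using hv)
    have h2 : dist (s (X v)) (s (X 0)) < ε := by
      apply hus
      · rw [hX0, dist_zero_right] at h1
        rw [mem_closedBall_zero_iff]; linarith
      · exact hWb 0 hW0
      · linarith
    rw [hX0, Real.dist_eq, abs_lt] at h2
    have h3 : s (X v) < -ε := by linarith [h2.2]
    refine ⟨?_, fun _ => ?_⟩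
    · simp only [W, Set.mem_setOf_eq]; linarith
    · have : ¬ (-ε < s (X v)) := by linarith
      simp only [c, sg, if_neg this, and_self]
  · intro p hp hp0 hpW
    have hnear : ∀ k ≠ 0, -ε < s (X (p k)) := by
      intro k hk
      have h1 : dist (X (p k)) (X (p 0)) ≤ h := hXd _ _ (fun i => walk_diff hp k 0 i)
      have h2 : dist (s (X (p k))) (s (X (p 0))) < ε := by
        apply hus
        · exact hWb _ (hpW k hk)
        · rw [mem_closedBall_zero_iff]
          have a1 := hWR _ (hpW k hk)
          rw [dist_eq_norm] at h1
          have a2 : ‖X (p 0)‖ ≤ ‖X (p k)‖ + ‖X (p k) - X (p 0)‖ := by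
            have := norm_sub_le (X (p k)) (X (p k) - X (p 0))
            simpa using this
          linarith
        · linarith
      simp only [W, Set.mem_setOf_eq, not_le] at hp0
      rw [Real.dist_eq, abs_lt] at h2
      linarith [h2.1]
    have hc' : ∀ k ≠ 0, c (p k) = gc (p k) := fun k hk => by simp only [c, if_pos (hnear k hk)]
    have hs' : ∀ k ≠ 0, sg (p k) = gs (p k) := fun k hk => by simp only [sg, if_pos (hnear k hk)]
    refine ⟨fun k hk => ?_, fun k hk l hl hkl => ?_⟩
    · rw [hc' k hk]; exact (hgspec _ (hpW k hk) (hnear k hk)).1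
    · rw [hc' k hk, hc' l hl] at hkl
      rw [hs' k hk, hs' l hl]
      obtain ⟨h1, h2⟩ := hgspec _ (hpW k hk) (hnear k hk)
      obtain ⟨h3, h4⟩ := hgspec _ (hpW l hl) (hnear l hl)
      rw [hgsv (p k) ⟨gc (p k), h1⟩ rfl, hgsv (p l) ⟨gc (p k), h1⟩ hkl.symm, decide_eq_decide]
      have h5 : (⟨gc (p l), h3⟩ : Fin M) = ⟨gc (p k), h1⟩ := Fin.ext hkl.symm
      rw [h5] at h4
      have h6 : dist (G (X (p k))) (G (X (p l))) < ε := by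
        apply huG _ (hWb _ (hpW k hk)) _ (hWb _ (hpW l hl))
        have := hXd _ _ (fun i => walk_diff hp k l i)
        linarith
      have h7 := lt_of_le_of_lt (dist_le_pi_dist _ _ (⟨gc (p k), h1⟩ : Fin M)) h6
      rw [Real.dist_eq, abs_lt] at h7
      rcases le_abs.1 h2 with h2 | h2 <;> rcases le_abs.1 h4 with h4 | h4 <;>
        constructor <;> intro _ <;> linarith [h7.1, h7.2]

theorem borsuk {A C : Type*} [NormedAddCommGroup A] [NormedSpace ℝ A] [FiniteDimensional ℝ A]
    [NormedAddCommGroup C] [NormedSpace ℝ C] [FiniteDimensional ℝ C]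
    (hdim : Module.finrank ℝ C < Module.finrank ℝ A)
    (G : A → C) (hG : Continuous G) (hGo : ∀ x, G (-x) = - G x) (s : A → ℝ) (hs : Continuous s)
    (hse : ∀ x, s (-x) = s x) (hs0 : s 0 < 0) (R : ℝ) (hR : ∀ x, R ≤ ‖x‖ → 0 < s x) :
    ∃ x, G x = 0 ∧ s x = 0 := by
  obtain ⟨M, hM⟩ : ∃ M, Module.finrank ℝ A = M + 1 := ⟨Module.finrank ℝ A - 1, by omega⟩
  have e1 : Module.finrank ℝ (Fin (M+1) → ℝ) = Module.finrank ℝ A := by simp [hM]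
  let φ : (Fin (M+1) → ℝ) ≃L[ℝ] A := ContinuousLinearEquiv.ofFinrankEq e1
  have e2 : Module.finrank ℝ C ≤ Module.finrank ℝ (Fin M → ℝ) := by simp; omega
  obtain ⟨ι, hι⟩ := finrank_le_iff_exists_linearMap.1 e2
  have hιc : Continuous ι := ι.continuous_of_finiteDimensional
  obtain ⟨x, h1, h2⟩ := borsuk_std (fun x => ι (G (φ x))) (by fun_prop) (fun x => by simp [hGo])
    (fun x => s (φ x)) (by fun_prop) (fun x => by simp [hse]) (by simpa using hs0)
    ((‖(φ.symm : A →L[ℝ] (Fin (M+1) → ℝ))‖ + 1) * (|R| + 1)) (by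
      intro x hx
      apply hR
      by_contra hlt
      rw [not_le] at hlt
      have h3 : ‖x‖ ≤ ‖(φ.symm : A →L[ℝ] (Fin (M+1) → ℝ))‖ * ‖φ x‖ := by
        have := (φ.symm : A →L[ℝ] (Fin (M+1) → ℝ)).le_opNorm (φ x)
        simpa using this
      have h4 : ‖φ x‖ < |R| + 1 := by linarith [le_abs_self R]
      have h5 : 0 ≤ ‖(φ.symm : A →L[ℝ] (Fin (M+1) → ℝ))‖ := norm_nonneg _
      nlinarith [norm_nonneg (φ x), abs_nonneg R])
  exact ⟨φ x, hι (by simpa using h1), h2⟩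


/-! ### Ekeland's variational principle -/

theorem ekeland {X : Type*} [MetricSpace X] [CompleteSpace X] (Φ : X → ℝ)
    (hΦ : LowerSemicontinuous Φ) (c : ℝ) (hc : ∀ x, c ≤ Φ x) (x0 : X) (ε : ℝ) (hε : 0 < ε)
    (h0 : Φ x0 ≤ c + ε ^ 2) :
    ∃ x1, Φ x1 ≤ Φ x0 ∧ dist x0 x1 ≤ ε ∧ ∀ x, Φ x1 - ε * dist x x1 ≤ Φ x := by
  let S : X → Set X := fun x => {y | Φ y + ε * dist x y ≤ Φ x}
  have hS : ∀ x y, y ∈ S x ↔ Φ y + ε * dist x y ≤ Φ x := fun x y => Iff.rfl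
  have hself : ∀ x, x ∈ S x := fun x => by simp [hS]
  have htrans : ∀ x y z, y ∈ S x → z ∈ S y → z ∈ S x := by
    intro x y z h1 h2
    rw [hS] at *
    have := dist_triangle x y z
    nlinarith
  have hclosed : ∀ x, IsClosed (S x) := by
    intro x
    have : LowerSemicontinuous (fun y => Φ y + ε * dist x y) :=
      hΦ.add (Continuous.lowerSemicontinuous (by fun_prop))
    exact this.isClosed_preimage (Φ x)
  have hnext : ∀ (n : ℕ) (x : X), ∃ y ∈ S x, ∀ z ∈ S x, Φ y ≤ Φ z + (1/2 : ℝ)^n := by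
    intro n x
    have hbdd : BddBelow (Φ '' S x) := ⟨c, by rintro _ ⟨y, -, rfl⟩; exact hc y⟩
    have hne : (Φ '' S x).Nonempty := ⟨_, x, hself x, rfl⟩
    obtain ⟨_, ⟨y, hy, rfl⟩, hlt⟩ := exists_lt_of_csInf_lt hne
      (show sInf (Φ '' S x) < sInf (Φ '' S x) + (1/2:ℝ)^n by
        have : (0:ℝ) < (1/2)^n := by positivity
        linarith)
    refine ⟨y, hy, fun z hz => ?_⟩
    have := csInf_le hbdd ⟨z, hz, rfl⟩
    linarith
  choose next hn1 hn2 using hnext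
  let x : ℕ → X := fun n => Nat.rec x0 (fun n y => next n y) n
  have hx0 : x 0 = x0 := rfl
  have hxs : ∀ n, x (n+1) = next n (x n) := fun n => rfl
  have hmem : ∀ n m, n ≤ m → x m ∈ S (x n) := by
    intro n m hnm
    induction m, hnm using Nat.le_induction with
    | base => exact hself _
    | succ m _ ih => exact htrans _ _ _ ih (by rw [hxs]; exact hn1 _ _)
  have hanti : Antitone (fun n => Φ (x n)) := by
    intro n m hnm
    have := (hS _ _).1 (hmem n m hnm)
    have h2 : 0 ≤ ε * dist (x n) (x m) := by positivity
    simp only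
    linarith
  have hbd : BddBelow (Set.range fun n => Φ (x n)) := ⟨c, by rintro _ ⟨n, rfl⟩; exact hc _⟩
  have hlim := tendsto_atTop_ciInf hanti hbd
  set ℓ := ⨅ n, Φ (x n) with hℓ
  have hℓle : ∀ n, ℓ ≤ Φ (x n) := fun n => ciInf_le hbd n
  have hcau : CauchySeq x := by
    refine cauchySeq_of_le_tendsto_0' (fun n => (Φ (x n) - ℓ) / ε) ?_ ?_
    · intro n m hnm
      rw [le_div_iff₀ hε]
      have := (hS _ _).1 (hmem n m hnm)
      have := hℓle m
      linarith
    · have := (hlim.sub_const ℓ).div_const ε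
      simpa using this
  obtain ⟨x1, hx1⟩ := cauchySeq_tendsto_of_complete hcau
  have hx1S : ∀ n, x1 ∈ S (x n) := fun n =>
    (hclosed (x n)).mem_of_tendsto hx1 (eventually_atTop.2 ⟨n, fun m hm => hmem n m hm⟩)
  refine ⟨x1, ?_, ?_, ?_⟩
  · have := (hS _ _).1 (hx1S 0)
    rw [hx0] at this
    have h2 : 0 ≤ ε * dist x0 x1 := by positivity
    linarith
  · have := (hS _ _).1 (hx1S 0)
    rw [hx0] at this
    have h3 := hc x1
    have : ε * dist x0 x1 ≤ ε * ε := by nlinarith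
    exact le_of_mul_le_mul_left this hε
  · intro z
    by_contra hlt
    rw [not_le] at hlt
    have hz1 : z ∈ S x1 := by rw [hS, dist_comm]; linarith
    have hzn : ∀ n, z ∈ S (x n) := fun n => htrans _ _ _ (hx1S n) hz1
    have hd : ∀ n, dist (x (n+1)) z ≤ (1/2:ℝ)^n / ε := by
      intro n
      rw [le_div_iff₀ hε]
      have h1 := (hS _ _).1 (hzn (n+1))
      have h2 := hn2 n (x n) z (hzn n)
      rw [← hxs] at h2
      linarith
    have hz : Tendsto (fun n => x (n+1)) atTop (𝓝 z) := by
      rw [tendsto_iff_dist_tendsto_zero]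
      refine squeeze_zero (fun _ => dist_nonneg) hd ?_
      have := (tendsto_pow_atTop_nhds_zero_of_lt_one (r := (1/2:ℝ)) (by norm_num) (by norm_num)).div_const ε
      simpa using this
    have heq : z = x1 := tendsto_nhds_unique hz (hx1.comp (tendsto_add_atTop_nat 1))
    subst heq
    simp at hlt

/-! ### The deformation-free minimax step -/

open BoundedContinuousFunction

section Step
variable {E : Type*} [NormedAddCommGroup E] [NormedSpace ℝ E]

def Gam (A : Submodule ℝ E) (R : ℝ) : Set (A →ᵇ E) :=
  {h | (∀ u, h (-u) = - h u) ∧ ∀ u, R ≤ ‖u‖ → h u = 0}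

theorem Gam_closed (A : Submodule ℝ E) (R : ℝ) : IsClosed (Gam A R) := by
  have h1 : ∀ u : A, Continuous (fun h : A →ᵇ E => h u) := fun u =>
    (BoundedContinuousFunction.lipschitz_eval_const u).continuous
  have : Gam A R = (⋂ u : A, {h | h (-u) = - h u}) ∩ ⋂ u : A, ⋂ _ : R ≤ ‖u‖, {h | h u = 0} := by
    ext h; simp [Gam]
  rw [this]
  refine IsClosed.inter (isClosed_iInter fun u => ?_)
    (isClosed_iInter fun u => isClosed_iInter fun _ => ?_)
  · exact isClosed_eq (h1 _) (h1 _).neg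
  · exact isClosed_eq (h1 _) continuous_const

theorem fderiv_odd {J : E → ℝ} (hJeven : ∀ u : E, J (-u) = J u) (x : E) :
    fderiv ℝ J (-x) = - fderiv ℝ J x := by
  have h1 : (fun x => J ((-1 : ℝ) • x)) = J := funext fun x => by simp [hJeven]
  have h2 := fderiv_comp_smul (𝕜 := ℝ) (f := J) (x := x) (-1)
  rw [h1] at h2
  rw [h2]; simp

theorem minimax_step [CompleteSpace E] (A : Submodule ℝ E) [FiniteDimensional ℝ A]
    {J : E → ℝ} (hJ : ContDiff ℝ 1 J) (hJeven : ∀ u : E, J (-u) = J u)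
    {R : ℝ} (hR : ∀ u : A, R ≤ ‖u‖ → J u < 0)
    {Z : Set A} (hZc : IsClosed Z) (hZs : ∀ u ∈ Z, -u ∈ Z) (hZb : ∀ u ∈ Z, ‖u‖ ≤ R)
    {c : ℝ} (hc : 0 < c) (hlow : ∀ h ∈ Gam A R, ∃ u ∈ Z, c ≤ J (u + h u))
    {h0 : A →ᵇ E} (hh0 : h0 ∈ Gam A R) {ε : ℝ} (hε : 0 < ε)
    (hup : ∀ u ∈ Z, J (u + h0 u) ≤ c + ε ^ 2) :
    ∃ w : E, ∃ u ∈ Z, ‖w - (u + h0 u)‖ ≤ ε ∧ c ≤ J w ∧ J w ≤ c + ε ^ 2 ∧ ‖fderiv ℝ J w‖ ≤ ε := by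
  have hJc : Continuous J := hJ.continuous
  have hJ' : Continuous (fderiv ℝ J) := hJ.continuous_fderiv (by norm_num)
  have hZcpt : IsCompact Z := by
    refine (isCompact_closedBall (0 : A) R).of_isClosed_subset hZc (fun u hu => ?_)
    rw [mem_closedBall_zero_iff]; exact hZb u hu
  have hZne : Z.Nonempty := by
    obtain ⟨u, hu, -⟩ := hlow h0 hh0; exact ⟨u, hu⟩
  have hgc : ∀ h : A →ᵇ E, Continuous (fun u : A => J (u + h u)) := fun h => by
    have := h.continuous
    fun_prop
  let Φ : Gam A R → ℝ := fun h => sSup ((fun u : A => J (u + h.1 u)) '' Z)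
  have hΦle : ∀ (h : Gam A R), ∀ u ∈ Z, J (u + h.1 u) ≤ Φ h := by
    intro h u hu
    exact le_csSup (hZcpt.image (hgc h.1)).bddAbove ⟨u, hu, rfl⟩
  have hΦex : ∀ (h : Gam A R), ∃ u ∈ Z, J (u + h.1 u) = Φ h := by
    intro h
    obtain ⟨u, hu, h1⟩ := hZcpt.exists_sSup_image_eq hZne (hgc h.1).continuousOn
    exact ⟨u, hu, h1.symm⟩
  have hΦlsc : LowerSemicontinuous Φ := by
    rw [lowerSemicontinuous_iff_isClosed_preimage]
    intro a
    have : Φ ⁻¹' Set.Iic a = ⋂ u ∈ Z, {h : Gam A R | J (u + h.1 u) ≤ a} := by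
      ext h
      simp only [Set.mem_preimage, Set.mem_Iic, Set.mem_iInter, Set.mem_setOf_eq]
      constructor
      · intro h1 u hu; exact (hΦle h u hu).trans h1
      · intro h1
        obtain ⟨u, hu, h2⟩ := hΦex h
        rw [← h2]; exact h1 u hu
    rw [this]
    refine isClosed_iInter fun u => isClosed_iInter fun _ => ?_
    have h1 : Continuous (fun h : Gam A R => h.1 u) :=
      (BoundedContinuousFunction.lipschitz_eval_const u).continuous.comp continuous_subtype_val
    exact isClosed_le (by fun_prop) continuous_const
  haveI : CompleteSpace (Gam A R) := (Gam_closed A R).completeSpace_coe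
  obtain ⟨h1, hE1, hE2, hE3⟩ := ekeland Φ hΦlsc c (by
    intro h
    obtain ⟨u, hu, h2⟩ := hlow h.1 h.2
    exact h2.trans (hΦle h u hu)) ⟨h0, hh0⟩ ε hε (by
    obtain ⟨u, hu, h2⟩ := hΦex ⟨h0, hh0⟩
    rw [← h2]; exact hup u hu)
  have hΦ0 : Φ ⟨h0, hh0⟩ ≤ c + ε^2 := by
    obtain ⟨u, hu, h2⟩ := hΦex ⟨h0, hh0⟩
    rw [← h2]; exact hup u hu
  set a := Φ h1 with ha
  have hac : c ≤ a := by
    obtain ⟨u, hu, h2⟩ := hlow h1.1 h1.2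
    exact h2.trans (hΦle h1 u hu)
  let g : A → E := fun u => u + h1.1 u
  have hg : Continuous g := by
    have := h1.1.continuous
    fun_prop
  have hgodd : ∀ u, g (-u) = - g u := by
    intro u; simp only [g, h1.2.1 u, Submodule.coe_neg]; abel
  -- it suffices to find a maximum point with small derivative
  suffices hs : ∃ u ∈ Z, J (g u) = a ∧ ‖fderiv ℝ J (g u)‖ ≤ ε by
    obtain ⟨u, hu, h2, h3⟩ := hs
    refine ⟨g u, u, hu, ?_, ?_, ?_, h3⟩
    · have h4 : dist (h0 u) (h1.1 u) ≤ dist h0 h1.1 := BoundedContinuousFunction.dist_coe_le_dist u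
      have h5 : dist h0 h1.1 ≤ ε := hE2
      rw [dist_comm, dist_eq_norm] at h4
      have : g u - (u + h0 u) = h1.1 u - h0 u := by simp only [g]; abel
      rw [this]; linarith
    · rw [h2]; exact hac
    · rw [h2]; linarith
  by_contra hcon
  push Not at hcon
  let T : Set A := {u | u ∈ Z ∧ J (g u) = a}
  have hTc : IsClosed T := hZc.inter (isClosed_eq (by fun_prop) continuous_const)
  have hTs : ∀ u ∈ T, -u ∈ T := fun u hu => ⟨hZs u hu.1, by rw [hgodd, hJeven]; exact hu.2⟩
  have hTR : ∀ u ∈ T, ‖u‖ < R := by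
    intro u hu
    by_contra hlt
    have h2 := hR u (not_lt.1 hlt)
    have h3 := hu.2
    simp only [g, h1.2.2 u (not_lt.1 hlt), add_zero] at h3
    linarith
  let D : A → (E →L[ℝ] ℝ) := fun u => fderiv ℝ J (g u)
  have hD : Continuous D := hJ'.comp hg
  let t : A → Set E := fun u => {v | ‖v‖ ≤ 1 ∧ (u ∈ T → D u v < -ε) ∧ (R ≤ ‖u‖ → v = 0)}
  obtain ⟨v, hv⟩ : ∃ v : C(A, E), ∀ u, v u ∈ t u := by
    apply exists_continuous_forall_mem_convex_of_local_const
    · intro u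
      rintro x ⟨hx1, hx2, hx3⟩ y ⟨hy1, hy2, hy3⟩ p q hp hq hpq
      refine ⟨?_, ?_, ?_⟩
      · calc ‖p • x + q • y‖ ≤ ‖p • x‖ + ‖q • y‖ := norm_add_le _ _
          _ = p * ‖x‖ + q * ‖y‖ := by
            rw [norm_smul, norm_smul, Real.norm_of_nonneg hp, Real.norm_of_nonneg hq]
          _ ≤ p * 1 + q * 1 := by gcongr
          _ = 1 := by linarith
      · intro hu
        have := hx2 hu
        have := hy2 hu
        simp only [map_add, map_smul, smul_eq_mul]
        have hq' : q = 1 - p := by linarith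
        subst hq'
        rcases hp.eq_or_lt with h | h
        · subst h; simp; assumption
        · nlinarith
      · intro hu
        rw [hx3 hu, hy3 hu]; simp
    · intro u
      by_cases hu : u ∈ T
      · have hlt := hcon u hu.1 hu.2
        obtain ⟨x, hx1, hx2⟩ := (D u).exists_lt_apply_of_lt_opNorm hlt
        obtain ⟨y, hy1, hy2⟩ : ∃ y : E, ‖y‖ ≤ 1 ∧ D u y < -ε := by
          rw [Real.norm_eq_abs, lt_abs] at hx2
          rcases hx2 with h | h
          · exact ⟨-x, by rw [norm_neg]; exact hx1.le, by rw [map_neg]; linarith⟩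
          · exact ⟨x, hx1.le, by linarith⟩
        refine ⟨y, ?_⟩
        have e1 : ∀ᶠ u' in 𝓝 u, D u' y < -ε := by
          have : Continuous (fun u' => D u' y) := by fun_prop
          exact this.continuousAt.eventually_lt_const hy2
        have e2 : ∀ᶠ u' in 𝓝 u, ‖u'‖ < R :=
          continuous_norm.continuousAt.eventually_lt_const (hTR u hu)
        filter_upwards [e1, e2] with u' h3 h4
        exact ⟨hy1, fun _ => h3, fun h5 => absurd h5 (not_le.2 h4)⟩
      · refine ⟨0, ?_⟩
        filter_upwards [hTc.isOpen_compl.mem_nhds hu] with u' hu'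
        exact ⟨by simp, fun h => absurd h hu', fun _ => rfl⟩
  let v' : A → E := fun u => (1/2 : ℝ) • (v u - v (-u))
  have hv'c : Continuous v' := by
    have := v.continuous
    fun_prop
  have hv'b : ∀ u, ‖v' u‖ ≤ 1 := by
    intro u
    have h2 := (hv u).1
    have h3 := (hv (-u)).1
    have h4 := norm_sub_le (v u) (v (-u))
    simp only [v', norm_smul]
    norm_num
    linarith
  have hv'o : ∀ u, v' (-u) = - v' u := by
    intro u
    simp only [v', neg_neg, ← smul_neg, neg_sub]
  have hv'0 : ∀ u, R ≤ ‖u‖ → v' u = 0 := by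
    intro u hu
    simp only [v', (hv u).2.2 hu, (hv (-u)).2.2 (by rwa [norm_neg]), sub_zero, smul_zero]
  have hv'T : ∀ u ∈ T, D u (v' u) < -ε := by
    intro u hu
    have h2 := (hv u).2.1 hu
    have h3 := (hv (-u)).2.1 (hTs u hu)
    have h4 : D (-u) = - D u := by simp only [D, hgodd, fderiv_odd hJeven]
    rw [h4, ContinuousLinearMap.neg_apply] at h3
    simp only [v', map_smul, map_sub, smul_eq_mul]
    linarith
  let vb : A →ᵇ E := BoundedContinuousFunction.ofNormedAddCommGroup v' hv'c 1 hv'b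
  have hvb : ∀ u, vb u = v' u := fun u => rfl
  have hvbn : ‖vb‖ ≤ 1 := BoundedContinuousFunction.norm_ofNormedAddCommGroup_le hv'c zero_le_one hv'b
  let τ : ℕ → ℝ := fun n => 1 / ((n : ℝ) + 1)
  have hτ : ∀ n, 0 < τ n := fun n => by positivity
  have hτ0 : Tendsto τ atTop (𝓝 0) := tendsto_one_div_add_atTop_nhds_zero_nat
  have hex : ∀ n, ∃ u ∈ Z, a - ε * τ n ≤ J (g u + τ n • v' u) := by
    intro n
    have hmem : h1.1 + τ n • vb ∈ Gam A R := by
      refine ⟨fun u => ?_, fun u hu => ?_⟩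
      · simp only [BoundedContinuousFunction.coe_add, BoundedContinuousFunction.coe_smul,
          Pi.add_apply, hvb, h1.2.1 u, hv'o, smul_neg]
        abel
      · simp only [BoundedContinuousFunction.coe_add, BoundedContinuousFunction.coe_smul,
          Pi.add_apply, hvb, h1.2.2 u hu, hv'0 u hu, smul_zero, add_zero]
    obtain ⟨u, hu, h2⟩ := hΦex ⟨_, hmem⟩
    refine ⟨u, hu, ?_⟩
    have h3 := hE3 ⟨_, hmem⟩
    rw [← h2] at h3
    have h4 : dist (⟨h1.1 + τ n • vb, hmem⟩ : Gam A R) h1 ≤ τ n := by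
      rw [Subtype.dist_eq, dist_eq_norm]
      simp only [add_sub_cancel_left, norm_smul, Real.norm_of_nonneg (hτ n).le]
      nlinarith [hτ n]
    have h5 : (u : E) + (h1.1 + τ n • vb) u = g u + τ n • v' u := by
      simp only [g, BoundedContinuousFunction.coe_add, BoundedContinuousFunction.coe_smul,
          Pi.add_apply, hvb]
      abel
    simp only [h5] at h3
    nlinarith
  choose u hu1 hu2 using hex
  obtain ⟨us, hus, φ, hφ, hlim⟩ := hZcpt.tendsto_subseq hu1
  have hτφ : Tendsto (fun n => τ (φ n)) atTop (𝓝 0) := hτ0.comp hφ.tendsto_atTop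
  have hgl : Tendsto (fun n => g (u (φ n))) atTop (𝓝 (g us)) := (hg.tendsto us).comp hlim
  have hvl : Tendsto (fun n => v' (u (φ n))) atTop (𝓝 (v' us)) := (hv'c.tendsto us).comp hlim
  have husT : us ∈ T := by
    refine ⟨hus, le_antisymm (hΦle h1 us hus) ?_⟩
    have l1 : Tendsto (fun n => J (g (u (φ n)) + τ (φ n) • v' (u (φ n)))) atTop (𝓝 (J (g us))) := by
      have := hgl.add (hτφ.smul hvl)
      rw [zero_smul, add_zero] at this
      exact (hJc.tendsto _).comp this
    have l2 : Tendsto (fun n => a - ε * τ (φ n)) atTop (𝓝 a) := by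
      have := (hτφ.const_mul ε).const_sub a
      simpa using this
    exact le_of_tendsto_of_tendsto' l2 l1 (fun n => hu2 (φ n))
  have hmv : ∀ n, ∃ z, ‖z - g (u n)‖ ≤ τ n ∧ -ε ≤ fderiv ℝ J z (v' (u n)) := by
    intro n
    obtain ⟨z, hz1, hz2⟩ := domain_mvt (f := J) (s := Set.univ) (f' := fderiv ℝ J)
      (x := g (u n)) (y := g (u n) + τ n • v' (u n))
      (fun x _ => ((hJ.differentiable (by norm_num)) x).hasFDerivAt.hasFDerivWithinAt)
      convex_univ trivial trivial
    refine ⟨z, ?_, ?_⟩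
    · have := norm_sub_le_of_mem_segment hz1
      rw [add_sub_cancel_left, norm_smul, Real.norm_of_nonneg (hτ n).le] at this
      nlinarith [hv'b (u n), hτ n]
    · rw [add_sub_cancel_left, map_smul, smul_eq_mul] at hz2
      have h2 := hu2 n
      have h3 := hΦle h1 (u n) (hu1 n)
      have h4 : τ n * (-ε) ≤ τ n * (fderiv ℝ J z) (v' (u n)) := by
        rw [← hz2]
        have : J (g (u n)) ≤ a := h3
        linarith
      exact le_of_mul_le_mul_left h4 (hτ n)
  choose z hz1 hz2 using hmv
  have hzl : Tendsto (fun n => z (φ n)) atTop (𝓝 (g us)) := by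
    have : Tendsto (fun n => z (φ n) - g (u (φ n))) atTop (𝓝 0) :=
      squeeze_zero_norm (fun n => hz1 (φ n)) hτφ
    have := this.add hgl
    simpa using this
  have hfl : Tendsto (fun n => fderiv ℝ J (z (φ n)) (v' (u (φ n)))) atTop (𝓝 (D us (v' us))) :=
    ((isBoundedBilinearMap_apply (𝕜 := ℝ) (E := E) (F := ℝ)).continuous.tendsto (D us, v' us)).comp
      (((hJ'.tendsto _).comp hzl).prodMk_nhds hvl)
  have := ge_of_tendsto' hfl (fun n => hz2 (φ n))
  have := hv'T us husT
  linarith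

end Step


/-! ### Assembly -/

theorem exists_dual_ne {E : Type*} [NormedAddCommGroup E] [NormedSpace ℝ E] (S : Finset E)
    (hS : (0 : E) ∉ S) : ∃ f : E →L[ℝ] ℝ, ∀ x ∈ S, f x ≠ 0 := by
  classical
  induction S using Finset.induction_on with
  | empty => exact ⟨0, by simp⟩
  | insert x S hx ih =>
    rw [Finset.mem_insert, not_or] at hS
    obtain ⟨f, hf⟩ := ih hS.2
    by_cases hfx : f x = 0
    · obtain ⟨g, hg⟩ := SeparatingDual.exists_ne_zero (R := ℝ) (x := x) (Ne.symm hS.1)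
      obtain ⟨t, ht⟩ := Infinite.exists_notMem_finset (insert (0 : ℝ) (S.image fun y => - f y / g y))
      rw [Finset.mem_insert, not_or] at ht
      refine ⟨f + t • g, fun y hy => ?_⟩
      rw [Finset.mem_insert] at hy
      rcases hy with rfl | hy
      · simp only [ContinuousLinearMap.add_apply, ContinuousLinearMap.smul_apply, hfx, zero_add, smul_eq_mul]
        exact mul_ne_zero ht.1 hg
      · simp only [ContinuousLinearMap.add_apply, ContinuousLinearMap.smul_apply, smul_eq_mul]
        intro h
        by_cases hgy : g y = 0
        · rw [hgy, mul_zero, add_zero] at h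
          exact hf y hy h
        · apply ht.2
          rw [Finset.mem_image]
          refine ⟨y, hy, ?_⟩
          rw [div_eq_iff hgy]; linarith
    · refine ⟨f, fun y hy => ?_⟩
      rw [Finset.mem_insert] at hy
      rcases hy with rfl | hy
      · exact hfx
      · exact hf y hy

theorem exists_pairs {E : Type*} [NormedAddCommGroup E] (S : Set E) (hS : S.Infinite) :
    ∃ U : ℕ → E, (∀ i, U i ∈ S) ∧ ∀ i j, i ≠ j → U i ≠ U j ∧ U i ≠ - U j := by
  classical
  obtain ⟨U, h1, h2⟩ := exists_seq_of_forall_finset_exists (fun x => x ∈ S)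
    (fun x y => y ≠ x ∧ y ≠ -x) (by
      intro s _
      obtain ⟨y, hy1, hy2⟩ := hS.exists_notMem_finset (s ∪ s.image (fun x => -x))
      refine ⟨y, hy1, fun x hx => ⟨?_, ?_⟩⟩
      · rintro rfl; exact hy2 (Finset.mem_union_left _ hx)
      · rintro rfl; exact hy2 (Finset.mem_union_right _ (Finset.mem_image_of_mem _ hx)))
  refine ⟨U, h1, fun i j hij => ?_⟩
  rcases lt_or_gt_of_ne hij with h | h
  · refine ⟨(h2 i j h).1.symm, fun h3 => (h2 i j h).2 ?_⟩
    rw [h3, neg_neg]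
  · exact h2 j i h

theorem closure_sphere {E : Type*} [NormedAddCommGroup E] [NormedSpace ℝ E] (X : Submodule ℝ E)
    {J : E → ℝ} (hJ : Continuous J) {ρ β : ℝ} (hρ : 0 < ρ)
    (hJ1 : ∀ u : E, u ∈ X → ‖u‖ = ρ → β ≤ J u) (x : E) (hx : x ∈ X.topologicalClosure)
    (hxn : ‖x‖ = ρ) : β ≤ J x := by
  have hx' : x ∈ closure (X : Set E) := hx
  haveI := mem_closure_iff_nhdsWithin_neBot.1 hx'
  have hx0 : x ≠ 0 := by rintro rfl; simp at hxn; linarith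
  have hc : ContinuousAt (fun y : E => J ((ρ / ‖y‖) • y)) x := by
    apply hJ.continuousAt.comp
    exact (continuousAt_const.div continuous_norm.continuousAt (by simpa using hx0)).smul
      continuousAt_id
  have h1 : J ((ρ / ‖x‖) • x) = J x := by rw [hxn, div_self hρ.ne', one_smul]
  have h2 : Tendsto (fun y : E => J ((ρ / ‖y‖) • y)) (𝓝[X] x) (𝓝 (J x)) := by
    rw [← h1]; exact hc.tendsto.mono_left nhdsWithin_le_nhds
  refine ge_of_tendsto h2 ?_
  have h3 : ∀ᶠ y in 𝓝[X] x, y ≠ 0 :=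
    (isOpen_ne.mem_nhds hx0 : {y : E | y ≠ 0} ∈ 𝓝 x) |> fun h => nhdsWithin_le_nhds h
  filter_upwards [h3, self_mem_nhdsWithin] with y hy hyX
  apply hJ1
  · exact X.smul_mem _ hyX
  · rw [norm_smul, norm_div, norm_norm, Real.norm_of_nonneg hρ.le]
    exact div_mul_cancel₀ _ (by simpa using hy)

section Final
variable {E : Type*} [NormedAddCommGroup E] [NormedSpace ℝ E]

theorem intersection (V X : Submodule ℝ E) (hVX : IsCompl V X) (hVfd : FiniteDimensional ℝ V)
    {J : E → ℝ} (hJ : Continuous J) {ρ β : ℝ} (hρ : 0 < ρ)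
    (hJ1 : ∀ u : E, u ∈ X → ‖u‖ = ρ → β ≤ J u)
    (A : Submodule ℝ E) [FiniteDimensional ℝ A] {R : ℝ} (hR : ρ < R) (j : ℕ)
    (hj : j + Module.finrank ℝ V < Module.finrank ℝ A)
    (h : A →ᵇ E) (hh : h ∈ Gam A R) (F : A → (Fin j → ℝ)) (hF : Continuous F)
    (hFo : ∀ u, F (-u) = - F u) : ∃ u : A, ‖u‖ ≤ R ∧ F u = 0 ∧ β ≤ J (u + h u) := by
  let X' := X.topologicalClosure
  haveI : IsClosed (X' : Set E) := X.isClosed_topologicalClosure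
  have hsurj : Function.Surjective (X'.mkQ ∘ₗ V.subtype) := by
    intro q
    obtain ⟨e, rfl⟩ := X'.mkQ_surjective q
    have he : e ∈ V ⊔ X := by rw [hVX.sup_eq_top]; trivial
    obtain ⟨v, hv, x, hx, rfl⟩ := Submodule.mem_sup.1 he
    refine ⟨⟨v, hv⟩, ?_⟩
    have : X'.mkQ x = 0 := by
      rw [Submodule.mkQ_apply, Submodule.Quotient.mk_eq_zero]
      exact X.le_topologicalClosure hx
    simp only [LinearMap.comp_apply, Submodule.subtype_apply, map_add, this, add_zero]
  haveI : FiniteDimensional ℝ (E ⧸ X') := Module.Finite.of_surjective _ hsurj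
  have hfr : Module.finrank ℝ (E ⧸ X') ≤ Module.finrank ℝ V :=
    LinearMap.finrank_le_finrank_of_surjective hsurj
  have hgc : Continuous (fun u : A => (u : E) + h u) := by
    have := h.continuous
    fun_prop
  have hgo : ∀ u : A, ((-u : A) : E) + h (-u) = - ((u : E) + h u) := by
    intro u; rw [hh.1, Submodule.coe_neg]; abel
  have hmk : Continuous (fun e : E => X'.mkQ e) := continuous_quot_mk
  obtain ⟨u, h1, h2⟩ := borsuk (A := A) (C := (E ⧸ X') × (Fin j → ℝ)) (by
      rw [Module.finrank_prod, Module.finrank_fin_fun]; omega)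
    (fun u => (X'.mkQ ((u : E) + h u), F u)) ((hmk.comp hgc).prodMk hF)
    (fun u => by rw [hgo, map_neg, hFo]; rfl)
    (fun u => ‖(u : E) + h u‖ - ρ) (by fun_prop) (fun u => by simp only [hgo, norm_neg])
    (by
      have : h 0 = 0 := by
        have := hh.1 0
        rw [neg_zero] at this
        have h2 : (2 : ℝ) • h 0 = 0 := by
          rw [two_smul]; nth_rewrite 1 [this]; exact neg_add_cancel _
        exact (smul_eq_zero.1 h2).resolve_left (by norm_num)
      simp [this, hρ])
    R (fun u hu => by
      simp only [hh.2 u hu, add_zero]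
      have : ‖(u : E)‖ = ‖u‖ := rfl
      rw [this]; linarith)
  rw [Prod.mk_eq_zero] at h1
  refine ⟨u, ?_, h1.2, ?_⟩
  · by_contra hlt
    rw [not_le] at hlt
    simp only [hh.2 u hlt.le, add_zero] at h2
    have : ‖(u : E)‖ = ‖u‖ := rfl
    rw [this] at h2; linarith
  · refine closure_sphere X hJ hρ hJ1 _ ?_ (by linarith)
    have := h1.1
    rwa [Submodule.mkQ_apply, Submodule.Quotient.mk_eq_zero] at this

def Adm (J : E → ℝ) (A : Submodule ℝ E) (R : ℝ) (j : ℕ) (a : ℝ) : Prop :=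
  ∃ h ∈ Gam A R, ∃ F : A → (Fin j → ℝ), Continuous F ∧ (∀ u, F (-u) = - F u) ∧
    ∀ u : A, ‖u‖ ≤ R → F u = 0 → J (u + h u) ≤ a

def lev (J : E → ℝ) (A : Submodule ℝ E) (R : ℝ) (j : ℕ) : ℝ := sInf {a | Adm J A R j a}

theorem core [CompleteSpace E] (A : Submodule ℝ E) [FiniteDimensional ℝ A]
    {J : E → ℝ} (hJ : ContDiff ℝ 1 J) (hJeven : ∀ u : E, J (-u) = J u) (hJ0 : J 0 = 0)
    {R β L : ℝ} (hβ : 0 < β) (hR : ∀ u : A, R ≤ ‖u‖ → J u < 0) (hL : ∀ u : A, J u ≤ L) (n : ℕ)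
    (hint : ∀ j < n, ∀ h ∈ Gam A R, ∀ F : A → (Fin j → ℝ), Continuous F →
      (∀ u, F (-u) = - F u) → ∃ u : A, ‖u‖ ≤ R ∧ F u = 0 ∧ β ≤ J (u + h u))
    (hPS : ∀ c ∈ Set.Icc (0 : ℝ) L, PalaisSmaleAt J c) :
    ∃ U : Fin n → E, (∀ i, fderiv ℝ J (U i) = 0 ∧ U i ≠ 0) ∧
      (∀ i j, i ≠ j → U i ≠ U j ∧ U i ≠ -U j) := by
  have hJc : Continuous J := hJ.continuous
  have hJ' : Continuous (fderiv ℝ J) := hJ.continuous_fderiv (by norm_num)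
  have hbdd : ∀ j < n, ∀ a, Adm J A R j a → β ≤ a := by
    rintro j hj a ⟨h, hh, F, hF, hFo, ha⟩
    obtain ⟨u, h1, h2, h3⟩ := hint j hj h hh F hF hFo
    exact h3.trans (ha u h1 h2)
  have hBB : ∀ j < n, BddBelow {a | Adm J A R j a} := fun j hj => ⟨β, fun a ha => hbdd j hj a ha⟩
  have hLadm : ∀ j, Adm J A R j L := fun j =>
    ⟨0, ⟨fun u => by simp, fun u _ => by simp⟩, fun _ => 0, continuous_const, fun u => by simp,
      fun u _ _ => by simpa using hL u⟩
  have hlevL : ∀ j < n, lev J A R j ≤ L := fun j hj => csInf_le (hBB j hj) (hLadm j)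
  have hlevβ : ∀ j < n, β ≤ lev J A R j := fun j hj =>
    le_csInf ⟨L, hLadm j⟩ (fun a ha => hbdd j hj a ha)
  have hadm : ∀ j < n, ∀ δ > 0, Adm J A R j (lev J A R j + δ) := by
    intro j hj δ hδ
    obtain ⟨a, ⟨h, hh, F, hF, hFo, ha⟩, hlt⟩ := exists_lt_of_csInf_lt (⟨L, hLadm j⟩ :
      {a | Adm J A R j a}.Nonempty) (show sInf {a | Adm J A R j a} < lev J A R j + δ by
        simp only [lev]; linarith)
    exact ⟨h, hh, F, hF, hFo, fun u h1 h2 => (ha u h1 h2).trans hlt.le⟩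
  have hcrit : ∀ j < n, ∀ f : E → ℝ, Continuous f →
      (∀ ε > 0, ∃ h ∈ Gam A R, ∃ F : A → (Fin j → ℝ), Continuous F ∧ (∀ u, F (-u) = - F u) ∧
        ∀ u : A, ‖u‖ ≤ R → F u = 0 → J (u + h u) ≤ lev J A R j + ε ^ 2 ∧ f (u + h u) = 0) →
      ∃ v, J v = lev J A R j ∧ fderiv ℝ J v = 0 ∧ f v = 0 := by
    intro j hj f hf H
    set c := lev J A R j with hc
    let τ : ℕ → ℝ := fun n => 1 / ((n : ℝ) + 1)
    have hτ : ∀ n, 0 < τ n := fun n => by positivity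
    have hτ0 : Tendsto τ atTop (𝓝 0) := tendsto_one_div_add_atTop_nhds_zero_nat
    have key : ∀ k, ∃ w y : E, ‖w - y‖ ≤ τ k ∧ f y = 0 ∧ c ≤ J w ∧ J w ≤ c + τ k ^ 2 ∧
        ‖fderiv ℝ J w‖ ≤ τ k := by
      intro k
      obtain ⟨h0, hh0, F, hF, hFo, hFz⟩ := H (τ k) (hτ k)
      let Z : Set A := {u | ‖u‖ ≤ R ∧ F u = 0}
      have hZc : IsClosed Z := (isClosed_le continuous_norm continuous_const).inter
        (isClosed_eq hF continuous_const)
      have hZcpt : IsCompact Z := by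
        refine (isCompact_closedBall (0 : A) R).of_isClosed_subset hZc (fun u hu => ?_)
        rw [mem_closedBall_zero_iff]; exact hu.1
      obtain ⟨w, u, hu, h1, h2, h3, h4⟩ := minimax_step A hJ hJeven hR hZc
        (fun u hu => ⟨by rw [norm_neg]; exact hu.1, by rw [hFo, hu.2, neg_zero]⟩)
        (fun u hu => hu.1) (c := c) (hβ.trans_le (hlevβ j hj)) (by
          intro h hh
          have hgc : Continuous (fun u : A => J ((u : E) + h u)) := by
            have := h.continuous
            fun_prop
          obtain ⟨u0, hu1, hu2, -⟩ := hint j hj h hh F hF hFo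
          obtain ⟨u, hu, hmax⟩ := hZcpt.exists_isMaxOn ⟨u0, hu1, hu2⟩ hgc.continuousOn
          refine ⟨u, hu, csInf_le (hBB j hj) ?_⟩
          exact ⟨h, hh, F, hF, hFo, fun u' h1 h2 => hmax ⟨h1, h2⟩⟩)
        hh0 (hτ k) (fun u hu => (hFz u hu.1 hu.2).1)
      exact ⟨w, u + h0 u, h1, (hFz u hu.1 hu.2).2, h2, h3, h4⟩
    choose w y k1 k2 k3 k4 k5 using key
    have l1 : Tendsto (fun k => J (w k)) atTop (𝓝 c) := by
      refine tendsto_of_tendsto_of_tendsto_of_le_of_le tendsto_const_nhds ?_ k3 k4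
      have := (hτ0.pow 2).const_add c
      simpa using this
    obtain ⟨v, φ, hφ, hlim⟩ := hPS c ⟨hβ.le.trans (hlevβ j hj), hlevL j hj⟩ w l1
      (squeeze_zero (fun _ => norm_nonneg _) k5 hτ0)
    have hφt := hφ.tendsto_atTop
    refine ⟨v, ?_, ?_, ?_⟩
    · exact tendsto_nhds_unique ((hJc.tendsto v).comp hlim) (l1.comp hφt)
    · have a1 : Tendsto (fun k => fderiv ℝ J (w (φ k))) atTop (𝓝 0) :=
        squeeze_zero_norm (fun k => k5 (φ k)) (hτ0.comp hφt)
      exact tendsto_nhds_unique ((hJ'.tendsto v).comp hlim) a1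
    · have a1 : Tendsto (fun k => w (φ k) - y (φ k)) atTop (𝓝 0) :=
        squeeze_zero_norm (fun k => k1 (φ k)) (hτ0.comp hφt)
      have a2 : Tendsto (fun k => y (φ k)) atTop (𝓝 v) := by
        have := hlim.sub a1
        simpa using this
      have a3 := (hf.tendsto v).comp a2
      have a4 : (f ∘ fun k => y (φ k)) = fun _ => 0 := funext fun k => k2 _
      rw [a4] at a3
      exact tendsto_nhds_unique a3 tendsto_const_nhds
  let K : ℕ → Set E := fun j => {v | J v = lev J A R j ∧ fderiv ℝ J v = 0}
  have hK0 : ∀ j < n, (0 : E) ∉ K j := by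
    intro j hj h
    have h1 := hlevβ j hj
    have h2 := h.1
    rw [hJ0] at h2
    linarith
  by_cases hinf : ∃ j < n, (K j).Infinite
  · obtain ⟨j, hj, hi⟩ := hinf
    obtain ⟨U, h1, h2⟩ := exists_pairs _ hi
    refine ⟨fun i => U i, fun i => ⟨(h1 i).2, fun h3 => hK0 j hj (h3 ▸ h1 i)⟩, fun i k hik => h2 _ _ ?_⟩
    exact fun h => hik (Fin.ext h)
  push Not at hinf
  have hdec : ∀ j, j + 1 < n → lev J A R (j+1) < lev J A R j := by
    intro j hj
    have hj' : j < n := by omega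
    -- padding of the constraint
    have hpad : ∀ δ > 0, ∀ f : E →L[ℝ] ℝ, ∃ h ∈ Gam A R, ∃ F : A → (Fin (j+1) → ℝ), Continuous F ∧
        (∀ u, F (-u) = - F u) ∧
        ∀ u : A, ‖u‖ ≤ R → F u = 0 → J (u + h u) ≤ lev J A R j + δ ∧ f (u + h u) = 0 := by
      intro δ hδ f
      obtain ⟨h, hh, F, hF, hFo, ha⟩ := hadm j hj' δ hδ
      have hc := h.continuous
      refine ⟨h, hh, fun u => Fin.cons (f (u + h u)) (F u), ?_, ?_, ?_⟩
      · refine continuous_pi fun i => ?_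
        refine Fin.cases ?_ (fun i => ?_) i
        · simp only [Fin.cons_zero]; fun_prop
        · simp only [Fin.cons_succ]; fun_prop
      · intro u
        funext i
        refine Fin.cases ?_ (fun i => ?_) i
        · simp only [Fin.cons_zero, Pi.neg_apply]
          rw [hh.1, Submodule.coe_neg, ← map_neg f]; congr 1; abel
        · simp only [Fin.cons_succ, Pi.neg_apply, hFo]
      · intro u hu hz
        refine ⟨ha u hu ?_, ?_⟩
        · funext i
          have := congrFun hz i.succ
          simpa using this
        · have := congrFun hz 0
          simpa using this
    have hle : lev J A R (j+1) ≤ lev J A R j := by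
      refine le_of_forall_pos_le_add fun δ hδ => ?_
      obtain ⟨h, hh, F, hF, hFo, ha⟩ := hpad δ hδ 0
      exact csInf_le (hBB _ hj) ⟨h, hh, F, hF, hFo, fun u h1 h2 => (ha u h1 h2).1⟩
    refine lt_of_le_of_ne hle fun heq => ?_
    have hfin : (K (j+1)).Finite := by
      have := hinf (j+1) hj
      simpa using this
    obtain ⟨f, hf⟩ := exists_dual_ne hfin.toFinset (by simpa using hK0 (j+1) hj)
    obtain ⟨v, h1, h2, h3⟩ := hcrit (j+1) hj f f.continuous (by
      intro ε hε
      rw [heq]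
      exact hpad (ε^2) (by positivity) f)
    exact hf v (by rw [Set.Finite.mem_toFinset]; exact ⟨h1, h2⟩) h3
  have hanti : ∀ j i, i < j → j < n → lev J A R j < lev J A R i := by
    intro j
    induction j with
    | zero => intro i hi; omega
    | succ j ih =>
      intro i hi hj
      have h1 := hdec j hj
      rcases Nat.lt_succ_iff_lt_or_eq.1 hi with h2 | h2
      · exact h1.trans (ih i h2 (by omega))
      · rw [h2]; exact h1
  have hex : ∀ i : Fin n, ∃ v, J v = lev J A R i ∧ fderiv ℝ J v = 0 := by
    intro i
    obtain ⟨v, h1, h2, -⟩ := hcrit i i.2 (fun _ => 0) continuous_const (by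
      intro ε hε
      obtain ⟨h, hh, F, hF, hFo, ha⟩ := hadm i i.2 (ε^2) (by positivity)
      exact ⟨h, hh, F, hF, hFo, fun u h1 h2 => ⟨ha u h1 h2, rfl⟩⟩)
    exact ⟨v, h1, h2⟩
  choose U hU1 hU2 using hex
  refine ⟨U, fun i => ⟨hU2 i, fun h => hK0 i i.2 (h ▸ ⟨hU1 i, hU2 i⟩)⟩, fun i k hik => ?_⟩
  have hne : J (U i) ≠ J (U k) := by
    rw [hU1, hU1]
    rcases lt_or_gt_of_ne (fun h => hik (Fin.ext h) : (i : ℕ) ≠ k) with h | h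
    · exact (hanti _ _ h k.2).ne'
    · exact (hanti _ _ h i.2).ne
  exact ⟨fun h => hne (by rw [h]), fun h => hne (by rw [h, hJeven])⟩

end Final

end SymCrit


/-- Lemma 5.2: a variant of the symmetric mountain pass theorem.
If `E = V ⊕ X` with `V` finite dimensional and `J` is an even `C¹` functional with
`J(0) = 0` satisfying (J1), (J2) and (J3), then `J` has at least
`dim Ẽ − dim V` pairs `{u, −u}` of nontrivial critical points. -/
theorem symmetric_critical_points {E : Type*} [NormedAddCommGroup E] [NormedSpace ℝ E]
    [CompleteSpace E]
    (V X : Subspace ℝ E) (hVX : IsCompl V X) (hVfd : FiniteDimensional ℝ V)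
    (J : E → ℝ) (hJC1 : ContDiff ℝ 1 J) (hJeven : ∀ u : E, J (-u) = J u) (hJ0 : J 0 = 0)
    -- (J1)
    (ρ β : ℝ) (hρ : 0 < ρ) (hβ : 0 < β)
    (hJ1 : ∀ u : E, u ∈ X → ‖u‖ = ρ → β ≤ J u)
    -- (J2)
    (Et : Subspace ℝ E) (hEtfd : FiniteDimensional ℝ Et)
    (hdim : Module.finrank ℝ V < Module.finrank ℝ Et)
    (hJ2 : Bornology.IsBounded {u : E | u ∈ Et ∧ 0 ≤ J u})
    -- (J3)
    (hJ3 : ∀ c ∈ Set.Icc (0 : ℝ) (sSup (J '' (Et : Set E))), PalaisSmaleAt J c) :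
    ∃ U : Fin (Module.finrank ℝ Et - Module.finrank ℝ V) → E,
      (∀ i, fderiv ℝ J (U i) = 0 ∧ U i ≠ 0) ∧
      (∀ i j, i ≠ j → U i ≠ U j ∧ U i ≠ -U j) := by
  have hJc : Continuous J := hJC1.continuous
  obtain ⟨R0, hR0⟩ := hJ2.exists_norm_le
  let R : ℝ := max R0 ρ + 1
  have hR1 : ρ < R := by have := le_max_right R0 ρ; simp only [R]; linarith
  have hR2 : R0 < R := by have := le_max_left R0 ρ; simp only [R]; linarith
  have hR : ∀ u : Et, R ≤ ‖u‖ → J u < 0 := by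
    intro u hu
    by_contra hlt
    have h1 := hR0 (u : E) ⟨u.2, not_lt.1 hlt⟩
    have : ‖(u : E)‖ = ‖u‖ := rfl
    rw [this] at h1; linarith
  have hbdd : BddAbove (J '' (Et : Set E)) := by
    have hcpt : IsCompact ((fun u : Et => J u) '' Metric.closedBall (0 : Et) R) :=
      (isCompact_closedBall (0 : Et) R).image (by fun_prop)
    obtain ⟨M, hM⟩ := hcpt.bddAbove
    refine ⟨max M 0, ?_⟩
    rintro _ ⟨u, hu, rfl⟩
    by_cases h : ‖(⟨u, hu⟩ : Et)‖ ≤ R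
    · exact (hM ⟨⟨u, hu⟩, by rwa [mem_closedBall_zero_iff], rfl⟩).trans (le_max_left _ _)
    · exact (hR ⟨u, hu⟩ (not_le.1 h).le).le.trans (le_max_right _ _)
  exact SymCrit.core Et hJC1 hJeven hJ0 hβ hR (L := sSup (J '' (Et : Set E)))
    (fun u => le_csSup hbdd ⟨u, u.2, rfl⟩) _
    (fun j hj h hh F hF hFo => SymCrit.intersection V X hVX hVfd hJc hρ hJ1 Et hR1 j
      (by omega) h hh F hF hFo) hJ3
end
end

section
/- Let p, q, r: ℝ^N → ℝ be continuous with 1 < inf ≤ sup < ∞ for each, and inf_{x∈ℝ^N}(r(x) − max{p(x), q(x)}) > 0. Let μ, ν be two finite nonnegative Radon measures on ℝ^N such that for some constant C > 0, ‖φ‖_{L^{r(·)}_ν(ℝ^N)} ≤ C·max{‖φ‖_{L^{p(·)}_μ(ℝ^N)}, ‖φ‖_{L^{q(·)}_μ(ℝ^N)}} for all φ ∈ C_c^∞(ℝ^N). Then there exist an at most countable set {x_i}_{i∈I} of distinct points in ℝ^N and positive numbers {ν_i}_{i∈I} such that ν = Σ_{i∈I} ν_i δ_{x_i}. -/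
open MeasureTheory Filter Topology Set
open scoped ENNReal NNReal

noncomputable section

/-- Euclidean space `ℝ^N`. -/
abbrev Euc (N : ℕ) := EuclideanSpace ℝ (Fin N)

/-- The modular of the variable exponent Lebesgue space `L^{h(·)}_μ`. -/
def varModular {α : Type*} [MeasurableSpace α] (μ : Measure α) (h : α → ℝ) (u : α → ℝ) : ℝ≥0∞ :=
  ∫⁻ x, ENNReal.ofReal (|u x| ^ (h x)) ∂μ

/-- The Luxemburg norm on the variable exponent Lebesgue space `L^{h(·)}_μ`. -/
def luxNorm {α : Type*} [MeasurableSpace α] (μ : Measure α) (h : α → ℝ) (u : α → ℝ) : ℝ :=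
  sInf {c : ℝ | 0 < c ∧ varModular μ h (fun x => u x / c) ≤ 1}

/-- Membership in the variable exponent Lebesgue space `L^{h(·)}_μ`. -/
def MemVarLp {α : Type*} [MeasurableSpace α] (μ : Measure α) (h : α → ℝ) (u : α → ℝ) : Prop :=
  AEStronglyMeasurable u μ ∧ varModular μ h u < ⊤

/-- The integrand of the Gagliardo-type seminorm with variable exponent. -/
def sobKernel {N : ℕ} (s : ℝ) (p : Euc N → Euc N → ℝ) (u : Euc N → ℝ) (x y : Euc N) : ℝ≥0∞ :=
  ENNReal.ofReal (|u x - u y| ^ (p x y) / dist x y ^ ((N : ℝ) + s * p x y))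

/-- The modular of the fractional Sobolev space `W^{s,p(·,·)}(Ω)`. -/
def sobModular {N : ℕ} (Ω : Set (Euc N)) (s : ℝ) (p : Euc N → Euc N → ℝ)
    (u : Euc N → ℝ) : ℝ≥0∞ :=
  (∫⁻ x in Ω, ENNReal.ofReal (|u x| ^ (p x x))) + ∫⁻ x in Ω, ∫⁻ y in Ω, sobKernel s p u x y

/-- The Luxemburg-type norm of the fractional Sobolev space `W^{s,p(·,·)}(Ω)`. -/
def sobNorm {N : ℕ} (Ω : Set (Euc N)) (s : ℝ) (p : Euc N → Euc N → ℝ) (u : Euc N → ℝ) : ℝ :=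
  sInf {c : ℝ | 0 < c ∧ sobModular Ω s p (fun x => u x / c) ≤ 1}

/-- Membership in the fractional Sobolev space `W^{s,p(·,·)}(Ω)`. -/
def MemSob {N : ℕ} (Ω : Set (Euc N)) (s : ℝ) (p : Euc N → Euc N → ℝ) (u : Euc N → ℝ) : Prop :=
  AEStronglyMeasurable u (volume.restrict Ω) ∧ sobModular Ω s p u < ⊤

lemma aux_right_cont {N : ℕ} (μ : Measure (Euc N)) [IsFiniteMeasure μ] (x : Euc N) (a : ℝ)
    (L : ℝ≥0∞) (h : μ (Metric.closedBall x a) < L) :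
    ∀ᶠ b in 𝓝[>] a, μ (Metric.closedBall x b) < L := by
  have h1 : Tendsto (fun b => μ (Metric.closedBall x b)) (𝓝[>] a)
      (𝓝 (μ (⋂ b > a, Metric.closedBall x b))) :=
    tendsto_measure_biInter_gt (fun r _ => Metric.isClosed_closedBall.nullMeasurableSet)
      (fun i j _ hij => Metric.closedBall_subset_closedBall hij)
      ⟨a + 1, by simp, measure_ne_top _ _⟩
  have h2 : (⋂ b > a, Metric.closedBall x b) = Metric.closedBall x a := by
    ext y
    simp only [mem_iInter, Metric.mem_closedBall]
    constructor
    · intro h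
      exact le_of_forall_gt_imp_ge_of_dense h
    · intro h b hb
      exact h.trans (le_of_lt hb)
  rw [h2] at h1
  exact h1.eventually (gt_mem_nhds h)

lemma aux_upper {N : ℕ} (μ : Measure (Euc N)) (p : Euc N → ℝ) (hp : ∀ x, 0 < p x)
    (x : Euc N) (φ : Euc N → ℝ) (b s m : ℝ) (hs : 0 < s) (hm : 0 < m) (hm1 : m ≤ 1)
    (hφ0 : ∀ y, 0 ≤ φ y) (hφ1 : ∀ y, φ y ≤ 1) (hφs : ∀ y, y ∉ Metric.closedBall x b → φ y = 0)
    (hps : ∀ y ∈ Metric.closedBall x b, p y ≤ s)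
    (hμ : μ (Metric.closedBall x b) ≤ ENNReal.ofReal m) :
    luxNorm μ p φ ≤ m ^ (1 / s) := by
  have hc : 0 < m ^ (1 / s) := Real.rpow_pos_of_pos hm _
  have hc1 : m ^ (1 / s) ≤ 1 := Real.rpow_le_one hm.le hm1 (by positivity)
  apply csInf_le ⟨0, fun c hc => hc.1.le⟩
  refine ⟨hc, ?_⟩
  unfold varModular
  calc ∫⁻ y, ENNReal.ofReal (|φ y / m ^ (1 / s)| ^ p y) ∂μ
      ≤ ∫⁻ y, (Metric.closedBall x b).indicator (fun _ => ENNReal.ofReal m⁻¹) y ∂μ := by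
        apply lintegral_mono
        intro y
        by_cases hy : y ∈ Metric.closedBall x b
        · simp only [indicator_of_mem hy]
          apply ENNReal.ofReal_le_ofReal
          rw [abs_of_nonneg (div_nonneg (hφ0 y) hc.le)]
          calc (φ y / m ^ (1 / s)) ^ p y ≤ (1 / m ^ (1 / s)) ^ p y := by
                apply Real.rpow_le_rpow (div_nonneg (hφ0 y) hc.le) _ (hp y).le
                gcongr
                exact hφ1 y
            _ ≤ (1 / m ^ (1 / s)) ^ s :=
                Real.rpow_le_rpow_of_exponent_le (by rw [le_div_iff₀ hc]; simpa using hc1) (hps y hy)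
            _ = m⁻¹ := by
                rw [one_div (m ^ (1 / s)), Real.inv_rpow hc.le, ← Real.rpow_mul hm.le]
                simp [hs.ne']
        · simp [hφs y hy, indicator_of_notMem hy, Real.zero_rpow (hp y).ne']
    _ = ENNReal.ofReal m⁻¹ * μ (Metric.closedBall x b) :=
        lintegral_indicator_const Metric.isClosed_closedBall.measurableSet _
    _ ≤ ENNReal.ofReal m⁻¹ * ENNReal.ofReal m := by gcongr
    _ = 1 := by
        rw [← ENNReal.ofReal_mul (by positivity), inv_mul_cancel₀ hm.ne', ENNReal.ofReal_one]

lemma aux_lower {N : ℕ} (ν : Measure (Euc N)) [IsFiniteMeasure ν] (r : Euc N → ℝ)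
    (hr : ∀ x, 1 < r x)
    (x : Euc N) (φ : Euc N → ℝ) (a t d : ℝ) (hd : 0 < d) (hd1 : d ≤ 1)
    (hφ0 : ∀ y, 0 ≤ φ y) (hφ1 : ∀ y, φ y ≤ 1) (hφs : ∀ y ∈ Metric.closedBall x a, φ y = 1)
    (hrt : ∀ y ∈ Metric.closedBall x a, t ≤ r y)
    (hlux : luxNorm ν r φ < d) :
    ν (Metric.closedBall x a) ≤ ENNReal.ofReal (d ^ t) := by
  have hne : {c : ℝ | 0 < c ∧ varModular ν r (fun x => φ x / c) ≤ 1}.Nonempty := by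
    refine ⟨max 1 (ν univ).toReal, by positivity, ?_⟩
    set c := max 1 (ν univ).toReal with hcdef
    have hc1 : 1 ≤ c := le_max_left _ _
    have hc0 : 0 < c := by positivity
    unfold varModular
    calc ∫⁻ y, ENNReal.ofReal (|φ y / c| ^ r y) ∂ν ≤ ∫⁻ y, ENNReal.ofReal c⁻¹ ∂ν := by
          apply lintegral_mono
          intro y
          apply ENNReal.ofReal_le_ofReal
          rw [abs_of_nonneg (div_nonneg (hφ0 y) hc0.le)]
          have h1 : φ y / c ≤ c⁻¹ := by
            rw [← one_div]; gcongr; exact hφ1 y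
          have h0 : 0 ≤ φ y / c := div_nonneg (hφ0 y) hc0.le
          calc (φ y / c) ^ r y ≤ (c⁻¹) ^ r y := Real.rpow_le_rpow h0 h1 (by linarith [hr y])
            _ ≤ (c⁻¹) ^ (1:ℝ) := Real.rpow_le_rpow_of_exponent_ge (by positivity)
                  (inv_le_one_of_one_le₀ hc1) (hr y).le
            _ = c⁻¹ := Real.rpow_one _
      _ = ENNReal.ofReal c⁻¹ * ν univ := lintegral_const _
      _ ≤ ENNReal.ofReal c⁻¹ * ENNReal.ofReal c := by
          gcongr
          rw [← ENNReal.ofReal_toReal (measure_ne_top ν univ)]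
          exact ENNReal.ofReal_le_ofReal (le_max_right _ _)
      _ = 1 := by
        rw [← ENNReal.ofReal_mul (by positivity), inv_mul_cancel₀ hc0.ne', ENNReal.ofReal_one]
  obtain ⟨c, ⟨hc0, hc⟩, hcd⟩ := exists_lt_of_csInf_lt hne hlux
  have hdt : 0 < d ^ t := Real.rpow_pos_of_pos hd _
  have key : ENNReal.ofReal (d ^ t)⁻¹ * ν (Metric.closedBall x a) ≤ 1 := by
    refine le_trans ?_ hc
    rw [← lintegral_indicator_const Metric.isClosed_closedBall.measurableSet]
    unfold varModular
    apply lintegral_mono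
    intro y
    by_cases hy : y ∈ Metric.closedBall x a
    · simp only [indicator_of_mem hy, hφs y hy]
      apply ENNReal.ofReal_le_ofReal
      rw [abs_of_nonneg (by positivity), ← Real.inv_rpow hd.le, one_div]
      have h1 : 1 ≤ d⁻¹ := (one_le_inv₀ hd).2 hd1
      calc (d⁻¹) ^ t ≤ (d⁻¹) ^ r y := Real.rpow_le_rpow_of_exponent_le h1 (hrt y hy)
        _ ≤ (c⁻¹) ^ r y := by
          apply Real.rpow_le_rpow (by positivity) _ (by linarith [hr y])
          gcongr
    · simp [indicator_of_notMem hy]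
  calc ν (Metric.closedBall x a)
      = ENNReal.ofReal (d ^ t) * (ENNReal.ofReal (d ^ t)⁻¹ * ν (Metric.closedBall x a)) := by
        rw [← mul_assoc, ← ENNReal.ofReal_mul hdt.le, mul_inv_cancel₀ hdt.ne', ENNReal.ofReal_one,
          one_mul]
    _ ≤ ENNReal.ofReal (d ^ t) * 1 := by gcongr
    _ = _ := mul_one _

lemma aux_ball {N : ℕ}
    (p q r : Euc N → ℝ)
    (hpc : Continuous p) (hqc : Continuous q) (hrc : Continuous r)
    (hp1 : ∀ x, 1 < p x) (hq1 : ∀ x, 1 < q x) (hr1 : ∀ x, 1 < r x)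
    (δ : ℝ) (hδ : 0 < δ) (hgap : ∀ x, max (p x) (q x) + δ ≤ r x)
    (μ ν : Measure (Euc N)) [IsFiniteMeasure μ] [IsFiniteMeasure ν]
    (C : ℝ) (hC : 0 < C)
    (hineq : ∀ φ : Euc N → ℝ, ContDiff ℝ (⊤ : ℕ∞) φ → HasCompactSupport φ →
      luxNorm ν r φ ≤ C * max (luxNorm μ p φ) (luxNorm μ q φ))
    (x : Euc N) (hx : μ {x} = 0) (η : ℝ) (hη : 0 < η) :
    ∀ᶠ a in 𝓝[>] (0:ℝ), ν (Metric.closedBall x a) ≤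
      ENNReal.ofReal η * μ (Metric.closedBall x a) := by
  set s := max (p x) (q x) + δ / 3 with hs
  set t := r x - δ / 3 with ht
  have hpx : p x ≤ max (p x) (q x) := le_max_left _ _
  have hqx : q x ≤ max (p x) (q x) := le_max_right _ _
  have hs0 : 0 < s := by linarith [hp1 x]
  have hst : s < t := by linarith [hgap x]
  -- radius
  have hev : ∀ᶠ y in 𝓝 x, p y < s ∧ q y < s ∧ t < r y :=
    (hpc.continuousAt.eventually (gt_mem_nhds (by linarith))).and
      ((hqc.continuousAt.eventually (gt_mem_nhds (by linarith))).and
        (hrc.continuousAt.eventually (lt_mem_nhds (by linarith))))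
  obtain ⟨ρ, hρ0, hρ⟩ := Metric.eventually_nhds_iff.1 hev
  -- threshold
  have hT1 : Tendsto (fun m : ℝ => 2 * C * m ^ (1 / s)) (𝓝[>] 0) (𝓝 0) := by
    have : ContinuousAt (fun m : ℝ => 2 * C * m ^ (1 / s)) 0 :=
      continuousAt_const.mul (Real.continuousAt_rpow_const _ _ (Or.inr (by positivity)))
    have h2 := this.tendsto
    simp only [Real.zero_rpow (one_div_pos.2 hs0).ne', mul_zero] at h2
    exact h2.mono_left nhdsWithin_le_nhds
  have hts : 0 < t / s - 1 := by
    rw [sub_pos, lt_div_iff₀ hs0]; linarith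
  have hT2 : Tendsto (fun m : ℝ => (2 * C) ^ t * m ^ (t / s - 1)) (𝓝[>] 0) (𝓝 0) := by
    have : ContinuousAt (fun m : ℝ => (2 * C) ^ t * m ^ (t / s - 1)) 0 :=
      continuousAt_const.mul (Real.continuousAt_rpow_const _ _ (Or.inr hts.le))
    have h2 := this.tendsto
    simp only [Real.zero_rpow hts.ne', mul_zero] at h2
    exact h2.mono_left nhdsWithin_le_nhds
  have hev2 : ∀ᶠ m in 𝓝[>] (0:ℝ), 2 * C * m ^ (1 / s) < 1 ∧ (2 * C) ^ t * m ^ (t / s - 1) < η ∧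
      m < 1 :=
    (hT1.eventually (gt_mem_nhds one_pos)).and ((hT2.eventually (gt_mem_nhds hη)).and
      (nhdsWithin_le_nhds (gt_mem_nhds one_pos)))
  obtain ⟨m₀, hm₀, hm⟩ := mem_nhdsGT_iff_exists_Ioo_subset.1 hev2
  have hm₀' : (0:ℝ) < m₀ := hm₀
  have hsmall : ∀ᶠ a in 𝓝[>] (0:ℝ), μ (Metric.closedBall x a) < ENNReal.ofReal m₀ := by
    apply aux_right_cont
    rw [Metric.closedBall_zero, hx]
    exact ENNReal.ofReal_pos.2 hm₀'
  filter_upwards [hsmall, self_mem_nhdsWithin, Ioo_mem_nhdsGT hρ0] with a ha ha0 haρ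
  have ha0' : 0 < a := ha0
  -- main estimate
  have main : ∀ m : ℝ, 0 < m → m < m₀ → μ (Metric.closedBall x a) < ENNReal.ofReal m →
      ν (Metric.closedBall x a) ≤ ENNReal.ofReal η * ENNReal.ofReal m := by
    intro m hm0 hmm hμm
    obtain ⟨h1, h2, h3⟩ := hm ⟨hm0, hmm⟩
    obtain ⟨b, hb, hba, hbρ⟩ := ((aux_right_cont μ x a _ hμm).and
      (Ioo_mem_nhdsGT haρ.2)).exists
    let f : ContDiffBump x := ⟨a, b, ha0', hba⟩
    have hsub : ∀ y ∈ Metric.closedBall x b, p y < s ∧ q y < s ∧ t < r y := fun y hy =>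
      hρ (lt_of_le_of_lt hy hbρ)
    have hz : ∀ y, y ∉ Metric.closedBall x b → f y = 0 := by
      intro y hy
      apply f.zero_of_le_dist
      simp only [Metric.mem_closedBall, not_le] at hy
      exact hy.le
    have hup : luxNorm μ p f ≤ m ^ (1 / s) :=
      aux_upper μ p (fun y => by linarith [hp1 y]) x f b s m hs0 hm0 h3.le (fun y => f.nonneg)
        (fun y => f.le_one) hz (fun y hy => (hsub y hy).1.le) hb.le
    have huq : luxNorm μ q f ≤ m ^ (1 / s) :=
      aux_upper μ q (fun y => by linarith [hq1 y]) x f b s m hs0 hm0 h3.le (fun y => f.nonneg)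
        (fun y => f.le_one) hz (fun y hy => (hsub y hy).2.1.le) hb.le
    have hcpos : 0 < m ^ (1 / s) := Real.rpow_pos_of_pos hm0 _
    have hlux : luxNorm ν r f < 2 * C * m ^ (1 / s) := by
      have := hineq f f.contDiff f.hasCompactSupport
      have h5 : C * max (luxNorm μ p f) (luxNorm μ q f) ≤ C * m ^ (1 / s) := by
        gcongr
        exact max_le hup huq
      nlinarith [mul_pos hC hcpos]
    have hlow := aux_lower ν r hr1 x f a t (2 * C * m ^ (1 / s)) (by positivity) h1.le
      (fun y => f.nonneg) (fun y => f.le_one) (fun y hy => f.one_of_mem_closedBall hy)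
      (fun y hy => (hsub y (Metric.closedBall_subset_closedBall hba.le hy)).2.2.le) hlux
    refine hlow.trans ?_
    rw [← ENNReal.ofReal_mul hη.le]
    apply ENNReal.ofReal_le_ofReal
    rw [Real.mul_rpow (by positivity) hcpos.le, ← Real.rpow_mul hm0.le]
    have h6 : m ^ (1 / s * t) = m ^ (t / s - 1) * m := by
      nth_rewrite 3 [← Real.rpow_one m]
      rw [← Real.rpow_add hm0]
      congr 1
      ring
    rw [h6, ← mul_assoc]
    gcongr
  -- limit
  have hfin : μ (Metric.closedBall x a) ≠ ⊤ := measure_ne_top _ _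
  set M := (μ (Metric.closedBall x a)).toReal with hM
  have hMe : μ (Metric.closedBall x a) = ENNReal.ofReal M := (ENNReal.ofReal_toReal hfin).symm
  have hM0 : 0 ≤ M := ENNReal.toReal_nonneg
  rw [hMe] at ha main ⊢
  have hMm : M < m₀ := (ENNReal.ofReal_lt_ofReal_iff hm₀').1 ha
  have hlim : Tendsto (fun m : ℝ => ENNReal.ofReal η * ENNReal.ofReal m) (𝓝[>] M)
      (𝓝 (ENNReal.ofReal η * ENNReal.ofReal M)) := by
    apply ENNReal.Tendsto.const_mul _ (Or.inr ENNReal.ofReal_ne_top)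
    exact (ENNReal.continuous_ofReal.tendsto M).mono_left nhdsWithin_le_nhds
  refine ge_of_tendsto hlim ?_
  filter_upwards [Ioo_mem_nhdsGT hMm] with m hmM
  have : 0 < m := lt_of_le_of_lt hM0 hmM.1
  exact main m this hmM.2 ((ENNReal.ofReal_lt_ofReal_iff this).2 hmM.1)

lemma aux_null {N : ℕ} (μ ν : Measure (Euc N)) [IsFiniteMeasure μ] [IsFiniteMeasure ν]
    (h : ∀ x, μ {x} = 0 → ∀ η : ℝ, 0 < η → ∀ᶠ a in 𝓝[>] (0:ℝ), ν (Metric.closedBall x a) ≤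
      ENNReal.ofReal η * μ (Metric.closedBall x a)) :
    ν {x | μ {x} = 0} = 0 := by
  set S := {x | μ {x} = 0}
  have h1 : ∀ η : ℝ, 0 < η → ν S ≤ ENNReal.ofReal η * μ S := by
    intro η hη
    have : IsFiniteMeasure (ENNReal.ofReal η • μ) := Measure.smul_finite μ ENNReal.ofReal_ne_top
    have := (Besicovitch.vitaliFamily ν).measure_le_of_frequently_le (ENNReal.ofReal η • μ)
      (Measure.AbsolutelyContinuous.refl ν) S (fun x hx => by
        refine (Besicovitch.tendsto_filterAt ν x).frequently (Eventually.frequently ?_)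
        filter_upwards [h x hx η hη] with a ha
        simpa using ha)
    simpa using this
  have hlim : Tendsto (fun η : ℝ => ENNReal.ofReal η * μ S) (𝓝[>] 0)
      (𝓝 (ENNReal.ofReal 0 * μ S)) := by
    apply ENNReal.Tendsto.mul_const _ (Or.inr (measure_ne_top _ _))
    exact (ENNReal.continuous_ofReal.tendsto 0).mono_left nhdsWithin_le_nhds
  have := ge_of_tendsto hlim (by filter_upwards [self_mem_nhdsWithin] with η hη using h1 η hη)
  simpa using this

lemma aux_atomic {N : ℕ} (μ ν : Measure (Euc N)) [IsFiniteMeasure μ] [IsFiniteMeasure ν]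
    (h : ν {x | μ {x} = 0} = 0) :
    ∃ (I : Set ℕ) (xi : ℕ → Euc N) (nui : ℕ → ℝ),
      (∀ i ∈ I, ∀ j ∈ I, i ≠ j → xi i ≠ xi j) ∧
      (∀ i ∈ I, 0 < nui i) ∧
      ν = Measure.sum (fun i : I => ENNReal.ofReal (nui i.1) • Measure.dirac (xi i.1)) := by
  have hD : Set.Countable {x | 0 < μ {x}} :=
    Measure.countable_meas_pos_of_disjoint_iUnion (μ := μ) (As := fun x : Euc N => {x})
      (fun i => measurableSet_singleton i) (fun i j hij => by simpa using hij)
  set E : Set (Euc N) := {x | 0 < μ {x} ∧ ν {x} ≠ 0} with hE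
  have hEc : E.Countable := hD.mono fun x hx => hx.1
  have hν : ∀ᵐ x ∂ν, x ∈ E := by
    have h1 : ν ({x | 0 < μ {x}} ∩ {x | ν {x} = 0}) = 0 := by
      have hc : ({x | 0 < μ {x}} ∩ {x | ν {x} = 0}).Countable := hD.mono inter_subset_left
      rw [← biUnion_of_singleton ({x | 0 < μ {x}} ∩ {x | ν {x} = 0}), measure_biUnion_null_iff hc]
      exact fun x hx => hx.2
    refine measure_mono_null ?_ (measure_union_null h h1)
    intro x hx
    simp only [hE, mem_compl_iff, mem_setOf_eq, not_and, not_not] at hx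
    by_cases h0 : μ {x} = 0
    · exact Or.inl h0
    · exact Or.inr ⟨pos_iff_ne_zero.2 h0, hx (pos_iff_ne_zero.2 h0)⟩
  obtain ⟨f, hf⟩ := Set.countable_iff_exists_injOn.1 hEc
  have hinv : ∀ i ∈ f '' E, Function.invFunOn f E i ∈ E ∧ f (Function.invFunOn f E i) = i :=
    fun i hi => ⟨Function.invFunOn_mem hi, Function.invFunOn_eq hi⟩
  have hdis : ∀ i ∈ f '' E, ∀ j ∈ f '' E, i ≠ j →
      Function.invFunOn f E i ≠ Function.invFunOn f E j := by
    intro i hi j hj hij he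
    apply hij
    rw [← (hinv i hi).2, ← (hinv j hj).2, he]
  refine ⟨f '' E, Function.invFunOn f E, fun i => (ν {Function.invFunOn f E i}).toReal, hdis,
    ?_, ?_⟩
  · intro i hi
    exact ENNReal.toReal_pos (hinv i hi).1.2 (measure_ne_top _ _)
  · have hU : E = ⋃ i : f '' E, {Function.invFunOn f E i.1} := by
      ext y
      simp only [mem_iUnion, mem_singleton_iff]
      constructor
      · intro hy
        have hy' := mem_image_of_mem f hy
        exact ⟨⟨f y, hy'⟩, hf hy (hinv _ hy').1 (hinv _ hy').2.symm⟩
      · rintro ⟨i, rfl⟩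
        exact (hinv _ i.2).1
    conv_lhs => rw [← Measure.restrict_eq_self_of_ae_mem hν, hU]
    rw [Measure.restrict_iUnion]
    · congr 1
      funext i
      rw [Measure.restrict_singleton, ENNReal.ofReal_toReal (measure_ne_top _ _)]
    · intro i j hij
      simpa using hdis i.1 i.2 j.1 j.2 (fun h => hij (Subtype.ext h))
    · exact fun i => measurableSet_singleton _

/-- Proposition A.1: a reversed-Hölder-type inequality between two
finite Radon measures forces the right-hand measure to be purely atomic. -/
theorem reversed_holder_atomic {N : ℕ}
    (p q r : Euc N → ℝ)
    (hpc : Continuous p) (hqc : Continuous q) (hrc : Continuous r)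
    (pminus pplus qminus qplus rminus rplus : ℝ)
    (hpm : ∀ x, pminus ≤ p x) (hpp : ∀ x, p x ≤ pplus) (hpm1 : 1 < pminus)
    (hqm : ∀ x, qminus ≤ q x) (hqp : ∀ x, q x ≤ qplus) (hqm1 : 1 < qminus)
    (hrm : ∀ x, rminus ≤ r x) (hrp : ∀ x, r x ≤ rplus) (hrm1 : 1 < rminus)
    (hgap : ∃ δ > (0 : ℝ), ∀ x, max (p x) (q x) + δ ≤ r x)
    (μ ν : Measure (Euc N)) (hμfin : IsFiniteMeasure μ) (hνfin : IsFiniteMeasure ν)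
    (C : ℝ) (hC : 0 < C)
    (hineq : ∀ φ : Euc N → ℝ, ContDiff ℝ (⊤ : ℕ∞) φ → HasCompactSupport φ →
      luxNorm ν r φ ≤ C * max (luxNorm μ p φ) (luxNorm μ q φ)) :
    ∃ (I : Set ℕ) (xi : ℕ → Euc N) (nui : ℕ → ℝ),
      (∀ i ∈ I, ∀ j ∈ I, i ≠ j → xi i ≠ xi j) ∧
      (∀ i ∈ I, 0 < nui i) ∧
      ν = Measure.sum (fun i : I => ENNReal.ofReal (nui i.1) • Measure.dirac (xi i.1)) := by
  obtain ⟨δ, hδ, hgap⟩ := hgap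
  exact aux_atomic μ ν (aux_null μ ν (aux_ball p q r hpc hqc hrc
    (fun x => lt_of_lt_of_le hpm1 (hpm x)) (fun x => lt_of_lt_of_le hqm1 (hqm x))
    (fun x => lt_of_lt_of_le hrm1 (hrm x)) δ hδ hgap μ ν C hC hineq))
end
end

section
/- Let p, q, r: ℝ^N → ℝ be continuous with 1 < inf ≤ sup < ∞ for each, and inf_{x∈ℝ^N}(r(x) − max{p(x), q(x)}) > 0. Let ν be a finite nonnegative Radon measure on ℝ^N such that for some constant C > 0, ‖φ‖_{L^{r(·)}_ν(ℝ^N)} ≤ C·max{‖φ‖_{L^{p(·)}_ν(ℝ^N)}, ‖φ‖_{L^{q(·)}_ν(ℝ^N)}} for all φ ∈ C_c^∞(ℝ^N). Then either ν = 0, or there exist finitely many distinct points x₁, …, x_n ∈ ℝ^N and positive numbers ν₁, …, ν_n such that ν = Σ_{i=1}^n ν_i δ_{x_i}. -/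
open MeasureTheory Filter Topology Set
open scoped ENNReal NNReal

noncomputable section

lemma aux_mem_upper {α : Type*} [MeasurableSpace α] (ν : Measure α) (h : α → ℝ) (φ : α → ℝ)
    (B : Set α) (hB : MeasurableSet B) (m b : ℝ) (hm : 0 < m) (hm1 : m ≤ 1)
    (hνB : ν B = ENNReal.ofReal m) (hb : 0 < b) (hpos : ∀ x, 0 < h x) (hhb : ∀ x ∈ B, h x ≤ b)
    (h01 : ∀ x, |φ x| ≤ 1) (hsupp : ∀ x, x ∉ B → φ x = 0) :
    m ^ (1 / b) ∈ {c : ℝ | 0 < c ∧ varModular ν h (fun x => φ x / c) ≤ 1} := by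
  have hc : 0 < m ^ (1 / b) := Real.rpow_pos_of_pos hm _
  have hc1 : m ^ (1 / b) ≤ 1 := Real.rpow_le_one hm.le hm1 (by positivity)
  have hcb : (m ^ (1 / b)) ^ b = m := by
    rw [← Real.rpow_mul hm.le, one_div_mul_cancel hb.ne', Real.rpow_one]
  generalize m ^ (1 / b) = c at hc hc1 hcb
  refine ⟨hc, ?_⟩
  unfold varModular
  calc ∫⁻ x, ENNReal.ofReal (|φ x / c| ^ h x) ∂ν
      ≤ ∫⁻ x, B.indicator (fun _ => ENNReal.ofReal (1 / m)) x ∂ν := by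
        apply lintegral_mono
        intro x
        by_cases hx : x ∈ B
        · simp only [hx, indicator_of_mem]
          apply ENNReal.ofReal_le_ofReal
          calc |φ x / c| ^ h x ≤ (1 / c) ^ h x := by
                apply Real.rpow_le_rpow (abs_nonneg _) _ (hpos x).le
                rw [abs_div, abs_of_pos hc]
                gcongr
                exact h01 x
            _ ≤ (1 / c) ^ b := Real.rpow_le_rpow_of_exponent_le
                (by rw [le_div_iff₀ hc]; simpa using hc1) (hhb x hx)
            _ = 1 / m := by rw [Real.div_rpow zero_le_one hc.le, hcb, Real.one_rpow]
        · simp [hx, hsupp x hx, Real.zero_rpow (hpos x).ne']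
    _ = 1 := by
        rw [lintegral_indicator_const hB, hνB, ← ENNReal.ofReal_mul (by positivity),
          one_div_mul_cancel hm.ne', ENNReal.ofReal_one]

lemma aux_lower_s12 {α : Type*} [MeasurableSpace α] (ν : Measure α) (h : α → ℝ) (φ : α → ℝ)
    (A : Set α) (hA : MeasurableSet A) (m a : ℝ) (hm : 0 < m) (hm1 : m ≤ 1)
    (hνA : ENNReal.ofReal m ≤ ν A) (ha : 0 < a) (hha : ∀ x ∈ A, a ≤ h x)
    (h1 : ∀ x ∈ A, φ x = 1) (c : ℝ)
    (hc : c ∈ {c : ℝ | 0 < c ∧ varModular ν h (fun x => φ x / c) ≤ 1}) :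
    m ^ (1 / a) ≤ c := by
  obtain ⟨hc, hmod⟩ := hc
  rcases le_or_gt 1 c with h1c | hc1
  · exact (Real.rpow_le_one hm.le hm1 (by positivity)).trans h1c
  have key : ENNReal.ofReal ((1 / c) ^ a * m) ≤ 1 := by
    refine le_trans ?_ hmod
    unfold varModular
    calc ENNReal.ofReal ((1 / c) ^ a * m)
        ≤ ENNReal.ofReal ((1 / c) ^ a) * ν A := by
          rw [ENNReal.ofReal_mul (by positivity)]; gcongr
      _ = ∫⁻ x, A.indicator (fun _ => ENNReal.ofReal ((1 / c) ^ a)) x ∂ν := by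
          rw [lintegral_indicator_const hA]
      _ ≤ _ := by
          apply lintegral_mono
          intro x
          by_cases hx : x ∈ A
          · simp only [hx, indicator_of_mem, h1 x hx]
            apply ENNReal.ofReal_le_ofReal
            rw [abs_of_pos (by positivity)]
            exact Real.rpow_le_rpow_of_exponent_le
                (by rw [le_div_iff₀ hc]; simpa using hc1.le) (hha x hx)
          · simp [hx]
  rw [ENNReal.ofReal_le_one, Real.div_rpow zero_le_one hc.le, Real.one_rpow, div_mul_eq_mul_div,
    one_mul, div_le_one (by positivity)] at key
  calc m ^ (1 / a) ≤ (c ^ a) ^ (1 / a) := Real.rpow_le_rpow hm.le key (by positivity)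
    _ = c := by rw [← Real.rpow_mul hc.le, mul_one_div_cancel ha.ne', Real.rpow_one]

lemma aux_arith (C δ R m a b : ℝ) (hC : 0 < C) (hδ : 0 < δ) (hm : 0 < m) (hm1 : m ≤ 1)
    (hb : 1 ≤ b) (hab : b + δ / 2 ≤ a) (haR : a ≤ R)
    (hε : m < (1 / (2 * C)) ^ (1 / (δ / (2 * R ^ 2))))
    (hle : (m / 2) ^ (1 / a) ≤ C * m ^ (1 / b)) : False := by
  have ha : 1 ≤ a := by linarith
  have hR : 0 < R := by linarith
  set κ := δ / (2 * R ^ 2) with hκ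
  have hκ0 : 0 < κ := by positivity
  have h1 : m ^ κ < 1 / (2 * C) := by
    calc m ^ κ < ((1 / (2 * C)) ^ (1 / κ)) ^ κ := Real.rpow_lt_rpow hm.le hε hκ0
      _ = _ := by rw [← Real.rpow_mul (by positivity), one_div_mul_cancel hκ0.ne', Real.rpow_one]
  have h2 : 1 / a + κ ≤ 1 / b := by
    have : κ ≤ (a - b) / (a * b) := by
      rw [hκ, div_le_div_iff₀ (by positivity) (by positivity)]
      have e1 : a * b ≤ R ^ 2 := by nlinarith
      have e2 : δ ≤ (a - b) * 2 := by linarith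
      calc δ * (a * b) ≤ ((a - b) * 2) * R ^ 2 := by gcongr; linarith
        _ = _ := by ring
    have e : (a - b) / (a * b) = 1 / b - 1 / a := by
      field_simp
    linarith
  have h3 : m ^ (1 / b) ≤ m ^ (1 / a) * m ^ κ := by
    rw [← Real.rpow_add hm]
    exact Real.rpow_le_rpow_of_exponent_ge hm hm1 h2
  have h4 : m ^ (1 / a) / 2 ≤ (m / 2) ^ (1 / a) := by
    rw [Real.div_rpow hm.le zero_le_two]
    gcongr
    calc (2 : ℝ) ^ (1 / a) ≤ 2 ^ (1 : ℝ) := Real.rpow_le_rpow_of_exponent_le one_le_two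
          (by rw [div_le_one (by linarith)]; exact ha)
      _ = 2 := Real.rpow_one 2
  have h5 : 0 < m ^ (1 / a) := by positivity
  have h6 : m ^ (1 / a) / 2 ≤ C * (m ^ (1 / a) * m ^ κ) := by
    refine h4.trans (hle.trans ?_); gcongr
  have h7 : C * (m ^ (1 / a) * m ^ κ) < C * (m ^ (1 / a) * (1 / (2 * C))) := by gcongr
  have h8 : C * (m ^ (1 / a) * (1 / (2 * C))) = m ^ (1 / a) / 2 := by field_simp
  linarith

lemma aux_local {N : ℕ}
    (p q r : Euc N → ℝ)
    (hpc : Continuous p) (hqc : Continuous q) (hrc : Continuous r)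
    (R δ : ℝ) (hδ : 0 < δ)
    (hp1 : ∀ x, 1 < p x) (hq1 : ∀ x, 1 < q x) (hr1 : ∀ x, 1 < r x) (hrR : ∀ x, r x ≤ R)
    (hgap : ∀ x, max (p x) (q x) + δ ≤ r x)
    (ν : Measure (Euc N)) (hνfin : IsFiniteMeasure ν)
    (C : ℝ) (hC : 0 < C)
    (hineq : ∀ φ : Euc N → ℝ, ContDiff ℝ (⊤ : ℕ∞) φ → HasCompactSupport φ →
      luxNorm ν r φ ≤ C * max (luxNorm ν p φ) (luxNorm ν q φ))
    (x : Euc N)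
    (hx : ν {x} < ENNReal.ofReal (min 1 ((1 / (2 * C)) ^ (1 / (δ / (2 * R ^ 2)))))) :
    ∃ V ∈ 𝓝 x, ν V = 0 := by
  set ε := min 1 ((1 / (2 * C)) ^ (1 / (δ / (2 * R ^ 2)))) with hε
  have hpx := hp1 x
  have hgx := hgap x
  have hmp := le_max_left (p x) (q x)
  have hmq := le_max_right (p x) (q x)
  set s := max (p x) (q x) with hs
  have e1 : ∀ᶠ y in 𝓝 x, p y < s + δ / 4 :=
    hpc.continuousAt.eventually_lt continuousAt_const (by linarith)
  have e2 : ∀ᶠ y in 𝓝 x, q y < s + δ / 4 :=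
    hqc.continuousAt.eventually_lt continuousAt_const (by linarith)
  have e3 : ∀ᶠ y in 𝓝 x, r x - δ / 4 < r y :=
    continuousAt_const.eventually_lt hrc.continuousAt (by linarith)
  obtain ⟨ρ₁, hρ₁, hball⟩ := Metric.eventually_nhds_iff_ball.1 (e1.and (e2.and e3))
  -- small ball
  have hU : ∃ U ⊇ ({x} : Set (Euc N)), IsOpen U ∧ ν U < ENNReal.ofReal ε :=
    Set.exists_isOpen_lt_of_lt _ _ hx
  obtain ⟨U, hxU, hUo, hUε⟩ := hU
  obtain ⟨ρ₂, hρ₂, hball₂⟩ := Metric.isOpen_iff.1 hUo x (hxU rfl)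
  set ρ := min ρ₁ ρ₂ with hρ
  have hρ0 : 0 < ρ := lt_min hρ₁ hρ₂
  refine ⟨Metric.ball x ρ, Metric.ball_mem_nhds x hρ0, ?_⟩
  by_contra hne
  have hfin : ν (Metric.ball x ρ) ≠ ⊤ := measure_ne_top _ _
  obtain ⟨m, hmdef⟩ : ∃ m, m = (ν (Metric.ball x ρ)).toReal := ⟨_, rfl⟩
  have hm : 0 < m := hmdef ▸ ENNReal.toReal_pos hne hfin
  have hνB : ν (Metric.ball x ρ) = ENNReal.ofReal m := by rw [hmdef, ENNReal.ofReal_toReal hfin]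
  have hmε : m < ε := by
    have : ENNReal.ofReal m < ENNReal.ofReal ε := by
      rw [← hνB]
      refine lt_of_le_of_lt (measure_mono ?_) hUε
      exact (Metric.ball_subset_ball (min_le_right _ _)).trans hball₂
    exact (ENNReal.ofReal_lt_ofReal_iff_of_nonneg hm.le).1 this
  have hm1 : m ≤ 1 := hmε.le.trans (min_le_left _ _)
  -- inner radius
  have hin : ∃ t, 0 < t ∧ t < ρ ∧ ENNReal.ofReal (m / 2) ≤ ν (Metric.closedBall x t) := by
    have hlt : ENNReal.ofReal (m / 2) < ν (Metric.ball x ρ) := by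
      rw [hνB]; exact (ENNReal.ofReal_lt_ofReal_iff hm).2 (by linarith)
    obtain ⟨K, hK, hKc, hKm⟩ := Metric.isOpen_ball.exists_lt_isCompact hlt
    obtain ⟨t, ht, hKt⟩ := exists_pos_lt_subset_ball hρ0 hKc.isClosed hK
    exact ⟨t, ht.1, ht.2, hKm.le.trans (measure_mono (hKt.trans Metric.ball_subset_closedBall))⟩
  obtain ⟨t, ht0, htρ, htm⟩ := hin
  let f : ContDiffBump x := ⟨t, ρ, ht0, htρ⟩
  have h01 : ∀ y, |f y| ≤ 1 := fun y => by rw [abs_of_nonneg f.nonneg]; exact f.le_one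
  have hsupp : ∀ y, y ∉ Metric.ball x ρ → f y = 0 := fun y hy =>
    f.zero_of_le_dist (by simpa using hy)
  have hb : ∀ y ∈ Metric.ball x ρ, p y < s + δ / 4 ∧ q y < s + δ / 4 ∧ r x - δ / 4 < r y :=
    fun y hy => hball y (Metric.ball_subset_ball (min_le_left _ _) hy)
  have hup : ∀ h : Euc N → ℝ, (∀ y, 1 < h y) → (∀ y ∈ Metric.ball x ρ, h y ≤ s + δ / 4) →
      luxNorm ν h f ≤ m ^ (1 / (s + δ / 4)) := fun h h1 h2 =>
    csInf_le ⟨0, fun c hc => hc.1.le⟩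
      (aux_mem_upper ν h f _ measurableSet_ball m _ hm hm1 hνB (by linarith)
        (fun y => by linarith [h1 y]) h2 h01 hsupp)
  have hlow : (m / 2) ^ (1 / (r x - δ / 4)) ≤ luxNorm ν r f := by
    refine le_csInf ⟨_, aux_mem_upper ν r f _ measurableSet_ball m R hm hm1 hνB
        (by linarith [hr1 x, hrR x])
        (fun y => by linarith [hr1 y]) (fun y _ => hrR y) h01 hsupp⟩ ?_
    intro c hc
    exact aux_lower_s12 ν r f (Metric.closedBall x t) measurableSet_closedBall (m / 2) _
      (by linarith) (by linarith) htm (by linarith)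
      (fun y hy => (hb y (Metric.closedBall_subset_ball htρ hy)).2.2.le)
      (fun y hy => f.one_of_mem_closedBall hy) c hc
  refine aux_arith C δ R m (r x - δ / 4) (s + δ / 4) hC hδ hm hm1 (by linarith) (by linarith)
    (by linarith [hrR x]) (hmε.trans_le (min_le_right _ _)) ?_
  refine hlow.trans ((hineq f f.contDiff f.hasCompactSupport).trans ?_)
  gcongr
  exact max_le (hup p hp1 fun y hy => (hb y hy).1.le) (hup q hq1 fun y hy => (hb y hy).2.1.le)

lemma aux_atoms {N : ℕ} (ν : Measure (Euc N)) [IsFiniteMeasure ν] (ε : ℝ≥0∞) (hε : 0 < ε)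
    (hloc : ∀ x, ν {x} < ε → ∃ V ∈ 𝓝 x, ν V = 0) :
    ∃ (n : ℕ) (xi : Fin n → Euc N) (nui : Fin n → ℝ),
      Function.Injective xi ∧ (∀ i, 0 < nui i) ∧
      ν = ∑ i : Fin n, ENNReal.ofReal (nui i) • Measure.dirac (xi i) := by
  have hF : Set.Finite {x : Euc N | ε ≤ ν {x}} :=
    Measure.finite_const_le_meas_of_disjoint_iUnion ν hε (fun x => measurableSet_singleton x)
      (fun x y hxy => by simpa [Function.onFun] using hxy) (measure_ne_top _ _)
  have hnull : ν {x : Euc N | ε ≤ ν {x}}ᶜ = 0 := by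
    apply measure_null_of_locally_null
    intro x hx
    obtain ⟨V, hV, h0⟩ := hloc x (by simpa using hx)
    exact ⟨V, mem_nhdsWithin_of_mem_nhds hV, h0⟩
  set F := hF.toFinset with hFdef
  let e := F.equivFin
  refine ⟨F.card, fun i => (e.symm i : Euc N), fun i => (ν {(e.symm i : Euc N)}).toReal,
    Subtype.val_injective.comp e.symm.injective, ?_, ?_⟩
  · intro i
    have hi : ε ≤ ν {(e.symm i : Euc N)} := by
      exact hF.mem_toFinset.1 (e.symm i).2
    exact ENNReal.toReal_pos (hε.trans_le hi).ne' (measure_ne_top _ _)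
  · have h1 : ν = ∑ y ∈ F, ν {y} • Measure.dirac y := by
      ext s hs
      have hc : (F : Set (Euc N)) = {x : Euc N | ε ≤ ν {x}} := hF.coe_toFinset
      rw [← measure_inter_add_sdiff s F.measurableSet,
        measure_mono_null (s := s \ (F : Set (Euc N))) (t := {x : Euc N | ε ≤ ν {x}}ᶜ) (by rw [← hc]; exact fun y hy => hy.2)
          hnull, add_zero]
      classical
      have : s ∩ (F : Set (Euc N)) = ((F.filter (· ∈ s) : Finset (Euc N)) : Set (Euc N)) := by
        ext y; simp [and_comm]
      rw [this, ← sum_measure_singleton, Finset.sum_filter, Measure.finsetSum_apply]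
      refine Finset.sum_congr rfl fun y _ => ?_
      by_cases hy : y ∈ s <;> simp [hy, Measure.dirac_apply' _ hs]
    conv_lhs => rw [h1]
    rw [← Finset.sum_coe_sort F, ← Equiv.sum_comp e.symm]
    refine Finset.sum_congr rfl fun i _ => ?_
    rw [ENNReal.ofReal_toReal (measure_ne_top _ _)]

/-- Lemma A.2: a reversed-Hölder-type inequality of a finite Radon
measure against itself forces the measure to vanish or to be a finite sum of atoms. -/
theorem reversed_holder_finitely_atomic {N : ℕ}
    (p q r : Euc N → ℝ)
    (hpc : Continuous p) (hqc : Continuous q) (hrc : Continuous r)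
    (pminus pplus qminus qplus rminus rplus : ℝ)
    (hpm : ∀ x, pminus ≤ p x) (hpp : ∀ x, p x ≤ pplus) (hpm1 : 1 < pminus)
    (hqm : ∀ x, qminus ≤ q x) (hqp : ∀ x, q x ≤ qplus) (hqm1 : 1 < qminus)
    (hrm : ∀ x, rminus ≤ r x) (hrp : ∀ x, r x ≤ rplus) (hrm1 : 1 < rminus)
    (hgap : ∃ δ > (0 : ℝ), ∀ x, max (p x) (q x) + δ ≤ r x)
    (ν : Measure (Euc N)) (hνfin : IsFiniteMeasure ν)
    (C : ℝ) (hC : 0 < C)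
    (hineq : ∀ φ : Euc N → ℝ, ContDiff ℝ (⊤ : ℕ∞) φ → HasCompactSupport φ →
      luxNorm ν r φ ≤ C * max (luxNorm ν p φ) (luxNorm ν q φ)) :
    ν = 0 ∨ ∃ (n : ℕ) (xi : Fin n → Euc N) (nui : Fin n → ℝ),
      Function.Injective xi ∧ (∀ i, 0 < nui i) ∧
      ν = ∑ i : Fin n, ENNReal.ofReal (nui i) • Measure.dirac (xi i) := by
  obtain ⟨δ, hδ, hg⟩ := hgap
  right
  refine aux_atoms ν (ENNReal.ofReal (min 1 ((1 / (2 * C)) ^ (1 / (δ / (2 * rplus ^ 2))))))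
    (ENNReal.ofReal_pos.2 (lt_min one_pos (by positivity))) ?_
  exact fun x hx => aux_local p q r hpc hqc hrc rplus δ hδ
    (fun y => hpm1.trans_le (hpm y)) (fun y => hqm1.trans_le (hqm y))
    (fun y => hrm1.trans_le (hrm y)) hrp hg ν hνfin C hC hineq x hx
end
end

section
/- Assume (P₂). Then for every continuous function t: ℝ^N → ℝ satisfying p_*(x) ≤ t(x) ≤ p̄_s^* for all x ∈ ℝ^N, the space W^{s,p(·,·)}(ℝ^N) embeds continuously into L^{t(·)}(ℝ^N): there exists C > 0 such that ‖u‖_{L^{t(·)}(ℝ^N)} ≤ C‖u‖_{s,p} for all u ∈ W^{s,p(·,·)}(ℝ^N). -/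
open MeasureTheory Filter Topology Set
open scoped ENNReal NNReal

noncomputable section

lemma aux_pointwise {N : ℕ} (hN : 0 < N) (s P q ε : ℝ) (hs : 0 < s) (hP : 0 < P) (hε : 0 < ε)
    (hq : 0 < q) (hqP : P + q * (s * P / N) = q) :
    ∃ C > (0:ℝ), ∀ (v : Euc N → ℝ) (m : ℝ), Measurable v → (∀ x, 0 ≤ v x) → 0 < m →
      (∫⁻ x, ENNReal.ofReal (v x ^ q)) = ENNReal.ofReal m → ∀ x,
      ENNReal.ofReal (v x ^ q) ≤ ENNReal.ofReal (C * m ^ (s * P / N)) *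
        (ENNReal.ofReal (v x ^ P) + ∫⁻ y in Metric.ball x ε,
          ENNReal.ofReal (|v x - v y| ^ P / dist x y ^ ((N:ℝ) + s * P))) := by
  obtain ⟨ω, hω, hωeq⟩ : ∃ ω : ℝ, 0 < ω ∧ volume (Metric.ball (0 : Euc N) 1) = ENNReal.ofReal ω := by
    refine ⟨(volume (Metric.ball (0 : Euc N) 1)).toReal, ?_, ?_⟩
    · exact ENNReal.toReal_pos (Metric.measure_ball_pos _ _ one_pos).ne' measure_ball_lt_top.ne
    · exact (ENNReal.ofReal_toReal measure_ball_lt_top.ne).symm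
  have hNR : (0:ℝ) < N := by exact_mod_cast hN
  set θ := s * P / N with hθ
  have hθN : θ * N = s * P := by rw [hθ]; field_simp
  refine ⟨(2 ^ (q + 1) / ω) ^ θ * (2 ^ (P + 1) / ω + ε ^ (-(s * P))), by positivity, ?_⟩
  intro v m hv hv0 hm hM x
  rcases (hv0 x).eq_or_lt with h0 | ha
  · rw [← h0, Real.zero_rpow hq.ne']; simp
  set a := v x with hadef
  set b : ℝ := 2 ^ (q + 1) / ω * m * a ^ (-q) with hb
  have hbpos : 0 < b := by positivity
  set r : ℝ := b ^ (1 / (N:ℝ)) with hr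
  have hrpos : 0 < r := by positivity
  have hrN : r ^ N = b := by
    rw [← Real.rpow_natCast, hr, ← Real.rpow_mul hbpos.le]; field_simp; simp
  have hrN' : r ^ (N:ℝ) = b := by rw [Real.rpow_natCast, hrN]
  have hrs : r ^ (s * P) = b ^ θ := by
    rw [← hθN, mul_comm, Real.rpow_mul hrpos.le, hrN']
  have key : a ^ q = (2 ^ (q + 1) / ω) ^ θ * m ^ θ * (a ^ P * r ^ (-(s * P))) := by
    rw [Real.rpow_neg hrpos.le, hrs, hb, Real.mul_rpow (by positivity) (by positivity),
      Real.mul_rpow (by positivity) (by positivity), ← Real.rpow_mul ha.le]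
    have : a ^ q = a ^ P * a ^ (q * θ) := by rw [← Real.rpow_add ha, hqP]
    rw [this, neg_mul, Real.rpow_neg ha.le]
    have h1 : (0:ℝ) < a ^ (q * θ) := by positivity
    have h2 : (0:ℝ) < m ^ θ := by positivity
    have h3 : (0:ℝ) < (2 ^ (q + 1) / ω) ^ θ := by positivity
    field_simp
  set D := ∫⁻ y in Metric.ball x ε,
          ENNReal.ofReal (|a - v y| ^ P / dist x y ^ ((N:ℝ) + s * P)) with hD
  have main : ENNReal.ofReal (a ^ P * r ^ (-(s * P))) ≤
      ENNReal.ofReal (2 ^ (P + 1) / ω + ε ^ (-(s * P))) * (ENNReal.ofReal (a ^ P) + D) := by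
    rcases le_total r ε with hrε | hrε
    · -- small radius
      set T := {y | ENNReal.ofReal ((a / 2) ^ q) ≤ ENNReal.ofReal (v y ^ q)} with hT
      have hTm : MeasurableSet T := measurableSet_le measurable_const (by fun_prop)
      have hTvol : volume T ≤ ENNReal.ofReal (ω * b / 2) := by
        have := mul_meas_ge_le_lintegral₀ (μ := (volume : Measure (Euc N)))
          (f := fun y => ENNReal.ofReal (v y ^ q)) (by fun_prop) (ENNReal.ofReal ((a / 2) ^ q))
        rw [hM] at this
        have h2 : (0:ℝ) < (a / 2) ^ q := by positivity
        have h3 : ENNReal.ofReal m = ENNReal.ofReal ((a / 2) ^ q) * ENNReal.ofReal (ω * b / 2) := by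
          rw [← ENNReal.ofReal_mul h2.le]
          congr 1
          rw [hb, Real.div_rpow ha.le (by norm_num), Real.rpow_neg ha.le, Real.rpow_add (by norm_num)]
          have h1 : (0:ℝ) < a ^ q := by positivity
          field_simp
          norm_num
        rw [h3] at this
        exact (ENNReal.mul_le_mul_iff_right (by simpa using h2) ENNReal.ofReal_ne_top).1 this
      set S := Metric.ball x r \ T with hS
      have hSm : MeasurableSet S := measurableSet_ball.diff hTm
      have hball : volume (Metric.ball x r) = ENNReal.ofReal (ω * b) := by
        rw [Measure.addHaar_ball_of_pos _ _ hrpos, hωeq, finrank_euclideanSpace, Fintype.card_fin, hrN,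
          ← ENNReal.ofReal_mul hbpos.le, mul_comm]
      have hSvol : ENNReal.ofReal (ω * b / 2) ≤ volume S := by
        refine le_trans ?_ (le_measure_sdiff (μ := volume) (s₁ := Metric.ball x r) (s₂ := T))
        rw [hball]
        refine le_trans ?_ (tsub_le_tsub_left hTvol _)
        rw [← ENNReal.ofReal_sub _ (by positivity)]
        apply ENNReal.ofReal_le_ofReal; linarith
      have hDlow : ENNReal.ofReal ((a / 2) ^ P / r ^ ((N:ℝ) + s * P)) * volume S ≤ D := by
        have hsub : S ⊆ Metric.ball x ε := fun y hy => Metric.ball_subset_ball hrε hy.1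
        refine le_trans ?_ (lintegral_mono_set hsub)
        rw [← setLIntegral_const]
        refine setLIntegral_mono' hSm ?_
        intro y hy
        apply ENNReal.ofReal_le_ofReal
        have hy2 : v y < a / 2 := by
          have := hy.2
          simp only [hT, mem_ofPred_eq, not_le] at this
          have h4 := (ENNReal.ofReal_lt_ofReal_iff (by positivity)).1 this
          exact (Real.rpow_lt_rpow_iff (hv0 y) (by positivity) hq).1 h4
        have hne : x ≠ y := by
          rintro rfl
          linarith
        have hd : 0 < dist x y := dist_pos.2 hne
        have hd2 : dist x y ≤ r := by
          have := hy.1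
          rw [Metric.mem_ball, dist_comm] at this
          exact this.le
        have habs : a / 2 ≤ |a - v y| := by
          refine le_trans ?_ (le_abs_self _); linarith
        gcongr
      calc ENNReal.ofReal (a ^ P * r ^ (-(s * P)))
          = ENNReal.ofReal (2 ^ (P + 1) / ω) * (ENNReal.ofReal ((a / 2) ^ P / r ^ ((N:ℝ) + s * P)) *
              ENNReal.ofReal (ω * b / 2)) := by
            rw [← ENNReal.ofReal_mul (by positivity), ← ENNReal.ofReal_mul (by positivity)]
            congr 1
            rw [Real.div_rpow ha.le (by norm_num), Real.rpow_neg hrpos.le, Real.rpow_add hrpos, hrN',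
              Real.rpow_add (by norm_num)]
            have : (0:ℝ) < r ^ (s * P) := by positivity
            field_simp
            norm_num
        _ ≤ ENNReal.ofReal (2 ^ (P + 1) / ω) * D := by
            gcongr
            exact le_trans (by gcongr) hDlow
        _ ≤ _ := by
            gcongr
            · have : (0:ℝ) < ε ^ (-(s * P)) := by positivity
              linarith
            · exact le_add_self
    · calc ENNReal.ofReal (a ^ P * r ^ (-(s * P)))
          ≤ ENNReal.ofReal ((2 ^ (P + 1) / ω + ε ^ (-(s * P))) * a ^ P) := by
            apply ENNReal.ofReal_le_ofReal
            have h1 : r ^ (-(s * P)) ≤ ε ^ (-(s * P)) :=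
              Real.rpow_le_rpow_of_nonpos hε hrε (by nlinarith [mul_pos hs hP])
            have h2 : (0:ℝ) < 2 ^ (P + 1) / ω := by positivity
            rw [mul_comm]
            gcongr
            linarith
        _ ≤ _ := by
            rw [ENNReal.ofReal_mul (by positivity)]
            gcongr
            exact le_self_add
  calc ENNReal.ofReal (a ^ q) = ENNReal.ofReal ((2 ^ (q + 1) / ω) ^ θ * m ^ θ) *
        ENNReal.ofReal (a ^ P * r ^ (-(s * P))) := by
        rw [← ENNReal.ofReal_mul (by positivity), ← key]
    _ ≤ ENNReal.ofReal ((2 ^ (q + 1) / ω) ^ θ * m ^ θ) *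
      (ENNReal.ofReal (2 ^ (P + 1) / ω + ε ^ (-(s * P))) * (ENNReal.ofReal (a ^ P) + D)) := by
        gcongr
    _ = _ := by
        rw [← mul_assoc, ← ENNReal.ofReal_mul (by positivity)]
        congr 2
        ring

/-- bounded nonnegative functions -/
lemma aux_bounded {N : ℕ} (hN : 0 < N) (s P q ε : ℝ) (hs : 0 < s) (hP : 0 < P) (hε : 0 < ε)
    (hq : P < q) (hqP : P + q * (s * P / N) = q) (hθ1 : s * P / N < 1) :
    ∃ C > (0:ℝ), ∀ (v : Euc N → ℝ) (k : ℝ), Measurable v → (∀ x, 0 ≤ v x) → (∀ x, v x ≤ k) →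
      (∫⁻ x, ENNReal.ofReal (v x ^ P)) + (∫⁻ x, ∫⁻ y in Metric.ball x ε,
          ENNReal.ofReal (|v x - v y| ^ P / dist x y ^ ((N:ℝ) + s * P))) ≤ 1 →
      (∫⁻ x, ENNReal.ofReal (v x ^ q)) ≤ ENNReal.ofReal C := by
  obtain ⟨C, hC, h⟩ := aux_pointwise hN s P q ε hs hP hε (hP.trans hq) hqP
  refine ⟨C ^ (1 / (1 - s * P / N)), by positivity, ?_⟩
  intro v k hv hv0 hvk hE
  set θ := s * P / N with hθ
  set M := ∫⁻ x, ENNReal.ofReal (v x ^ q) with hM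
  rcases eq_or_ne M 0 with h0 | h0
  · rw [h0]; exact zero_le
  have hfin : M < ⊤ := by
    calc M ≤ ∫⁻ x, ENNReal.ofReal (k ^ (q - P)) * ENNReal.ofReal (v x ^ P) := by
          refine lintegral_mono fun x => ?_
          have hk : 0 ≤ k := (hv0 x).trans (hvk x)
          rw [← ENNReal.ofReal_mul (by positivity)]
          apply ENNReal.ofReal_le_ofReal
          rcases (hv0 x).eq_or_lt with h0 | ha
          · rw [← h0, Real.zero_rpow (hP.trans hq).ne', Real.zero_rpow hP.ne']; simp
          · calc v x ^ q = v x ^ (q - P) * v x ^ P := by rw [← Real.rpow_add ha]; congr 1; ring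
              _ ≤ _ := by
                gcongr
                exact hvk x
      _ = ENNReal.ofReal (k ^ (q - P)) * ∫⁻ x, ENNReal.ofReal (v x ^ P) :=
          lintegral_const_mul' _ _ ENNReal.ofReal_ne_top
      _ < ⊤ := ENNReal.mul_lt_top ENNReal.ofReal_lt_top
          (lt_of_le_of_lt (le_self_add.trans hE) ENNReal.one_lt_top)
  set m := M.toReal with hm
  have hmpos : 0 < m := ENNReal.toReal_pos h0 hfin.ne
  have hMm : M = ENNReal.ofReal m := (ENNReal.ofReal_toReal hfin.ne).symm
  have hpt := h v m hv hv0 hmpos hMm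
  have h1 : M ≤ ENNReal.ofReal (C * m ^ θ) := by
    calc M ≤ ∫⁻ x, ENNReal.ofReal (C * m ^ θ) *
        (ENNReal.ofReal (v x ^ P) + ∫⁻ y in Metric.ball x ε,
          ENNReal.ofReal (|v x - v y| ^ P / dist x y ^ ((N:ℝ) + s * P))) := lintegral_mono hpt
      _ = ENNReal.ofReal (C * m ^ θ) * ((∫⁻ x, ENNReal.ofReal (v x ^ P)) +
          (∫⁻ x, ∫⁻ y in Metric.ball x ε,
          ENNReal.ofReal (|v x - v y| ^ P / dist x y ^ ((N:ℝ) + s * P)))) := by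
          rw [lintegral_const_mul' _ _ ENNReal.ofReal_ne_top, lintegral_add_left (by fun_prop)]
      _ ≤ ENNReal.ofReal (C * m ^ θ) * 1 := by gcongr
      _ = _ := mul_one _
  rw [hMm] at h1 ⊢
  have h2 := (ENNReal.ofReal_le_ofReal_iff (by positivity)).1 h1
  apply ENNReal.ofReal_le_ofReal
  have h3 : m ^ (1 - θ) ≤ C := by
    rw [Real.rpow_sub hmpos, Real.rpow_one, div_le_iff₀ (by positivity)]
    exact h2
  have h1θ : 0 < 1 - θ := by linarith
  calc m = (m ^ (1 - θ)) ^ (1 / (1 - θ)) := by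
        rw [← Real.rpow_mul hmpos.le, mul_one_div_cancel h1θ.ne', Real.rpow_one]
    _ ≤ _ := by gcongr

lemma aux_sobolev {N : ℕ} (hN : 0 < N) (s P q ε : ℝ) (hs : 0 < s) (hP : 0 < P) (hε : 0 < ε)
    (hq : P < q) (hqP : P + q * (s * P / N) = q) (hθ1 : s * P / N < 1) :
    ∃ C > (0:ℝ), ∀ (u : Euc N → ℝ), Measurable u →
      (∫⁻ x, ENNReal.ofReal (|u x| ^ P)) + (∫⁻ x, ∫⁻ y in Metric.ball x ε,
          ENNReal.ofReal (|u x - u y| ^ P / dist x y ^ ((N:ℝ) + s * P))) ≤ 1 →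
      (∫⁻ x, ENNReal.ofReal (|u x| ^ q)) ≤ ENNReal.ofReal C := by
  obtain ⟨C, hC, h⟩ := aux_bounded hN s P q ε hs hP hε hq hqP hθ1
  refine ⟨C, hC, fun u hu hE => ?_⟩
  have hk : ∀ k : ℕ, (∫⁻ x, ENNReal.ofReal ((min |u x| k) ^ q)) ≤ ENNReal.ofReal C := by
    intro k
    refine h (fun x => min |u x| k) k (by fun_prop) (fun x => by positivity)
      (fun x => min_le_right _ _) (le_trans ?_ hE)
    refine add_le_add (lintegral_mono fun x => ?_)
      (lintegral_mono fun x => lintegral_mono fun y => ?_)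
    · apply ENNReal.ofReal_le_ofReal
      gcongr
      exact min_le_left _ _
    · apply ENNReal.ofReal_le_ofReal
      have hle : |min |u x| (k:ℝ) - min |u y| (k:ℝ)| ≤ |u x - u y| := ?_
      · gcongr
      refine le_trans (abs_min_sub_min_le_max _ _ _ _) ?_
      simp only [sub_self, abs_zero]
      exact max_le (abs_abs_sub_abs_le _ _) (abs_nonneg _)
  calc (∫⁻ x, ENNReal.ofReal (|u x| ^ q))
      ≤ ∫⁻ x, liminf (fun k : ℕ => ENNReal.ofReal ((min |u x| k) ^ q)) atTop := by
        refine lintegral_mono fun x => ?_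
        refine le_of_eq (Tendsto.liminf_eq ?_).symm
        refine tendsto_const_nhds.congr' ?_
        obtain ⟨n, hn⟩ := exists_nat_ge |u x|
        filter_upwards [eventually_ge_atTop n] with k hk
        rw [min_eq_left]
        exact hn.trans (by exact_mod_cast hk)
    _ ≤ liminf (fun k : ℕ => ∫⁻ x, ENNReal.ofReal ((min |u x| k) ^ q)) atTop :=
        lintegral_liminf_le (fun k => by fun_prop)
    _ ≤ ENNReal.ofReal C := by
        refine le_trans (liminf_le_liminf (v := fun _ => ENNReal.ofReal C)
          (Eventually.of_forall hk)) ?_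
        simp


/-- under (P₂), for every continuous exponent t with
p_*(x) ≤ t(x) ≤ p̄_s^*, the space W^{s,p(·,·)}(ℝ^N) imbeds continuously
into L^{t(·)}(ℝ^N). -/
theorem critical_imbedding_between_pstar_and_critical {N : ℕ}
    (s pminus pbar ε₀ : ℝ) (hs : s ∈ Set.Ioo (0 : ℝ) 1)
    (p : Euc N → Euc N → ℝ) (pstar : Euc N → ℝ)
    (hpuc : UniformContinuous fun z : Euc N × Euc N => p z.1 z.2)
    (hpsym : ∀ x y, p x y = p y x)
    (hpminus : IsGLB (Set.range fun z : Euc N × Euc N => p z.1 z.2) pminus)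
    (hpbar : IsLUB (Set.range fun z : Euc N × Euc N => p z.1 z.2) pbar)
    (hpm1 : 1 < pminus) (hpbarN : pbar < (N : ℝ) / s)
    (hε₀ : ε₀ ∈ Set.Ioo (0 : ℝ) (1 / 2))
    (hdiag : ∀ x y : Euc N, dist x y < ε₀ → p x y = pbar)
    (hsupx : ∀ x : Euc N, IsLUB (Set.range (p x)) pbar)
    (hpstar : ∀ x : Euc N, IsGLB (Set.range (p x)) (pstar x))
    (hfin : volume {x : Euc N | pstar x ≠ pbar} < ⊤)
    (pbarS : ℝ) (hpbarS : pbarS = (N : ℝ) * pbar / ((N : ℝ) - s * pbar)) :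
    ∀ t : Euc N → ℝ, Continuous t → (∀ x, pstar x ≤ t x) → (∀ x, t x ≤ pbarS) →
      ∃ C > (0 : ℝ), ∀ u : Euc N → ℝ, MemSob Set.univ s p u →
        MemVarLp volume t u ∧ luxNorm volume t u ≤ C * sobNorm Set.univ s p u := by
  intro t htc ht1 ht2
  have hP1 : 1 < pbar := by
    refine hpm1.trans_le ((hpminus.1 ⟨(0, 0), rfl⟩).trans (hpbar.1 ⟨(0,0), rfl⟩))
  have hs0 := hs.1
  have hNR : (0:ℝ) < N := by
    have := hP1.trans hpbarN
    rw [lt_div_iff₀ hs0] at this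
    linarith
  have hN : 0 < N := by exact_mod_cast hNR
  have hsP : s * pbar < N := by rw [lt_div_iff₀ hs0] at hpbarN; linarith
  have hsub : 0 < (N:ℝ) - s * pbar := by linarith
  have hq : pbar < pbarS := by
    rw [hpbarS, lt_div_iff₀ hsub]
    nlinarith [mul_pos hs0 (by linarith : 0 < pbar), mul_pos (mul_pos hs0 (by linarith : 0 < pbar)) (by linarith : 0 < pbar)]
  have hqP : pbar + pbarS * (s * pbar / N) = pbarS := by
    have h := (eq_div_iff hsub.ne').1 hpbarS
    have h2 : pbarS * (s * pbar / N) = pbarS * (s * pbar) / N := by ring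
    have h3 : pbarS * (s * pbar) / N = pbarS - pbar := by
      rw [div_eq_iff hNR.ne']; linarith
    rw [h2, h3]; ring
  have hθ1 : s * pbar / N < 1 := by rw [div_lt_one hNR]; exact hsP
  obtain ⟨C₀, hC₀, hsob⟩ := aux_sobolev hN s pbar pbarS ε₀ hs0 (by linarith) hε₀.1 hq hqP hθ1
  have hlow : ∀ x y, pminus ≤ p x y := fun x y => hpminus.1 ⟨(x, y), rfl⟩
  have htlow : ∀ x, 1 < t x := fun x => by
    refine lt_of_lt_of_le (hpm1.trans_le ?_) (ht1 x)
    refine (hpstar x).2 ?_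
    rintro _ ⟨y, rfl⟩
    exact hlow x y
  set A := {x : Euc N | pstar x ≠ pbar} with hA
  set A' := toMeasurable volume A with hA'
  set V := (volume A).toReal with hV
  have hVA : volume A' = ENNReal.ofReal V := by
    rw [hA', measure_toMeasurable, hV, ENNReal.ofReal_toReal hfin.ne]
  have hV0 : 0 ≤ V := ENNReal.toReal_nonneg
  -- core estimate
  have core : ∀ w : Euc N → ℝ, AEStronglyMeasurable w volume → sobModular Set.univ s p w ≤ 1 →
      varModular volume t w ≤ ENNReal.ofReal (V + 1 + C₀) := by
    intro w hw hmod
    obtain ⟨w', hw', hww⟩ := hw.aemeasurable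
    have hE1 : (∫⁻ x, ENNReal.ofReal (|w' x| ^ pbar)) + (∫⁻ x, ∫⁻ y in Metric.ball x ε₀,
          ENNReal.ofReal (|w' x - w' y| ^ pbar / dist x y ^ ((N:ℝ) + s * pbar))) ≤ 1 := by
      refine le_trans ?_ hmod
      unfold sobModular
      simp only [Measure.restrict_univ]
      refine add_le_add ?_ ?_
      · refine lintegral_mono_ae ?_
        filter_upwards [hww] with x hx
        rw [hx, hdiag x x (by simpa using hε₀.1)]
      · refine lintegral_mono_ae ?_
        filter_upwards [hww] with x hx
        refine le_trans ?_ (setLIntegral_le_lintegral (Metric.ball x ε₀) _)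
        refine lintegral_mono_ae ?_
        filter_upwards [ae_restrict_of_ae hww, ae_restrict_mem measurableSet_ball] with y hy hyb
        rw [Metric.mem_ball, dist_comm] at hyb
        unfold sobKernel
        rw [hx, hy, hdiag x y hyb]
    have hI1 : (∫⁻ x, ENNReal.ofReal (|w' x| ^ pbar)) ≤ 1 := le_self_add.trans hE1
    have hI2 := hsob w' hw' hE1
    calc varModular volume t w
        ≤ ∫⁻ x, (A'.indicator (fun _ => (1:ℝ≥0∞)) x + (ENNReal.ofReal (|w' x| ^ pbar) +
            ENNReal.ofReal (|w' x| ^ pbarS))) := by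
          refine lintegral_mono_ae ?_
          filter_upwards [hww] with x hx
          rw [hx]
          rcases le_total 1 |w' x| with h1 | h1
          · refine le_trans ?_ (le_trans le_add_self le_add_self)
            exact ENNReal.ofReal_le_ofReal (Real.rpow_le_rpow_of_exponent_le h1 (ht2 x))
          · by_cases hxA : x ∈ A'
            · refine le_trans ?_ le_self_add
              rw [indicator_of_mem hxA, ← ENNReal.ofReal_one]
              exact ENNReal.ofReal_le_ofReal
                (Real.rpow_le_one (abs_nonneg _) h1 (by linarith [htlow x]))
            · refine le_trans ?_ (le_trans le_self_add le_add_self)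
              have hxA2 : pstar x = pbar := by
                by_contra hne
                exact hxA (subset_toMeasurable volume A hne)
              apply ENNReal.ofReal_le_ofReal
              refine Real.rpow_le_rpow_of_exponent_ge' (abs_nonneg _) h1 (by linarith) ?_
              rw [← hxA2]; exact ht1 x
      _ = volume A' + ((∫⁻ x, ENNReal.ofReal (|w' x| ^ pbar)) +
            ∫⁻ x, ENNReal.ofReal (|w' x| ^ pbarS)) := by
          rw [lintegral_add_left, lintegral_add_left (by fun_prop), lintegral_indicator_const, one_mul]
          · exact measurableSet_toMeasurable _ _
          · exact measurable_const.indicator (measurableSet_toMeasurable _ _)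
      _ ≤ ENNReal.ofReal V + (ENNReal.ofReal 1 + ENNReal.ofReal C₀) := by
          rw [hVA, ENNReal.ofReal_one]
          gcongr
      _ = _ := by
          rw [← ENNReal.ofReal_add (by norm_num) hC₀.le, ← ENNReal.ofReal_add hV0 (by linarith)]
          congr 1; ring
  -- scaling
  have scale : ∀ (e c z : ℝ), 1 ≤ e → 1 ≤ c → |z / c| ^ e ≤ c⁻¹ * |z| ^ e := by
    intro e c z he hc
    have hc0 : 0 < c := by linarith
    rw [abs_div, abs_of_pos hc0, Real.div_rpow (abs_nonneg _) hc0.le, div_eq_mul_inv, mul_comm]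
    gcongr
    calc c = c ^ (1:ℝ) := (Real.rpow_one c).symm
      _ ≤ c ^ e := Real.rpow_le_rpow_of_exponent_le hc he
  set C := V + 1 + C₀ with hCdef
  have hC1 : 1 ≤ C := by linarith
  have hCpos : 0 < C := by linarith
  refine ⟨C, hCpos, ?_⟩
  intro u hu
  obtain ⟨hum, hufin⟩ := hu
  rw [Measure.restrict_univ] at hum
  have hmeas : ∀ c : ℝ, AEStronglyMeasurable (fun x => u x / c) volume := fun c => by
    simpa only [div_eq_mul_inv] using hum.mul_const c⁻¹
  have hlux : ∀ c : ℝ, 0 < c → sobModular Set.univ s p (fun x => u x / c) ≤ 1 →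
      varModular volume t (fun x => u x / (C * c)) ≤ 1 := by
    intro c hc hmod
    have h1 := core _ (hmeas c) hmod
    calc varModular volume t (fun x => u x / (C * c))
        ≤ ∫⁻ x, ENNReal.ofReal C⁻¹ * ENNReal.ofReal (|u x / c| ^ t x) := by
          refine lintegral_mono fun x => ?_
          rw [← ENNReal.ofReal_mul (by positivity)]
          apply ENNReal.ofReal_le_ofReal
          have := scale (t x) C (u x / c) (htlow x).le hC1
          rwa [div_div, mul_comm c C] at this
      _ = ENNReal.ofReal C⁻¹ * varModular volume t (fun x => u x / c) :=
          lintegral_const_mul' _ _ ENNReal.ofReal_ne_top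
      _ ≤ ENNReal.ofReal C⁻¹ * ENNReal.ofReal C := by gcongr
      _ = 1 := by
          rw [← ENNReal.ofReal_mul (by positivity), inv_mul_cancel₀ hCpos.ne', ENNReal.ofReal_one]
  -- existence of an admissible constant
  obtain ⟨c₀, hc₀, hmod₀⟩ : ∃ c : ℝ, 1 ≤ c ∧ sobModular Set.univ s p (fun x => u x / c) ≤ 1 := by
    set m := (sobModular Set.univ s p u).toReal with hm
    have hm0 : 0 ≤ m := ENNReal.toReal_nonneg
    have hc : (1:ℝ) ≤ m + 1 := by linarith
    have hcp : (0:ℝ) < m + 1 := by linarith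
    refine ⟨m + 1, hc, ?_⟩
    have hle : sobModular Set.univ s p (fun x => u x / (m + 1)) ≤
        ENNReal.ofReal (m + 1)⁻¹ * sobModular Set.univ s p u := by
      unfold sobModular
      rw [mul_add, ← lintegral_const_mul' _ _ ENNReal.ofReal_ne_top,
        ← lintegral_const_mul' _ _ ENNReal.ofReal_ne_top]
      refine add_le_add (lintegral_mono fun x => ?_) (lintegral_mono fun x => ?_)
      · rw [← ENNReal.ofReal_mul (by positivity)]
        exact ENNReal.ofReal_le_ofReal (scale _ _ _ (hpm1.le.trans (hlow x x)) hc)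
      · rw [← lintegral_const_mul' _ _ ENNReal.ofReal_ne_top]
        refine lintegral_mono fun y => ?_
        unfold sobKernel
        rw [← ENNReal.ofReal_mul (by positivity), ← mul_div_assoc, ← sub_div]
        have := scale (p x y) (m + 1) (u x - u y) (hpm1.le.trans (hlow x y)) hc
        apply ENNReal.ofReal_le_ofReal
        gcongr
    refine hle.trans ?_
    rw [← ENNReal.ofReal_toReal hufin.ne, ← hm, ← ENNReal.ofReal_mul (by positivity),
      ← ENNReal.ofReal_one]
    apply ENNReal.ofReal_le_ofReal
    rw [inv_mul_le_iff₀ hcp]; linarith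
  have hc₀p : 0 < c₀ := by linarith
  refine ⟨⟨hum, ?_⟩, ?_⟩
  · have h1 := core _ (hmeas c₀) hmod₀
    calc varModular volume t u
        ≤ ∫⁻ x, ENNReal.ofReal (c₀ ^ pbarS) * ENNReal.ofReal (|u x / c₀| ^ t x) := by
          refine lintegral_mono fun x => ?_
          rw [← ENNReal.ofReal_mul (by positivity)]
          apply ENNReal.ofReal_le_ofReal
          calc |u x| ^ t x = c₀ ^ t x * |u x / c₀| ^ t x := by
                rw [← Real.mul_rpow hc₀p.le (abs_nonneg _), abs_div, abs_of_pos hc₀p,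
                  mul_div_cancel₀ _ hc₀p.ne']
            _ ≤ _ := by
                gcongr
                exact ht2 x
      _ = ENNReal.ofReal (c₀ ^ pbarS) * varModular volume t (fun x => u x / c₀) :=
          lintegral_const_mul' _ _ ENNReal.ofReal_ne_top
      _ < ⊤ := ENNReal.mul_lt_top ENNReal.ofReal_lt_top
          (lt_of_le_of_lt h1 ENNReal.ofReal_lt_top)
  · rw [← div_le_iff₀' hCpos]
    refine le_csInf ⟨c₀, hc₀p, hmod₀⟩ ?_
    rintro c ⟨hc, hmod⟩
    rw [div_le_iff₀' hCpos]
    refine csInf_le ⟨0, fun d hd => hd.1.le⟩ ⟨by positivity, hlux c hc hmod⟩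
end
end
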